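/- arXiv:2408.12858 — 2 statements merged into one kernel-verified Lean document; each statement's English description precedes it below -/
import Mathlib

section
/- Let n ≥ 1 and a_i^{(α)} ∈ ℂⁿ for i ∈ {1,2}, α ∈ {1,2,3}, with (a₁⁽³⁾, a₂⁽³⁾) ≠ (0,0), and set F_i(z) = Σ_{α=1}^3 a_i^{(α)} z^α. Assume condition (A)₄ holds and condition (B)_{4,c} holds for some constant c > 0. Then n ≥ 4 and there exist t ∈ (0,3] with t ≠ 2, a unitary P ∈ U(2), and a unitary Q ∈ U(n) such that, writing F(z) for the 2×n matrix with rows F₁(z), F₂(z), one has P·F(z)·Q equal for all z to the 2×n matrix with rows (F₁ᵗ(z), 0, …, 0) and (F₂ᵗ(z), 0, …, 0); moreover c = 4t − t². -/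
open scoped BigOperators
open Complex

noncomputable def hinner {m : ℕ} (u w : Fin m → ℂ) : ℂ :=
  ∑ i, u i * (starRingEnd ℂ) (w i)

noncomputable def gram {m k : ℕ} (v : Fin k → Fin m → ℂ) : ℂ :=
  Matrix.det (Matrix.of fun i j : Fin k => hinner (v i) (v j))

noncomputable def vOne {n : ℕ} (F : ℂ → Fin n → ℂ) (z : ℂ) : Fin (n + 2) → ℂ :=
  Fin.cons 1 (Fin.cons 0 (F z))

noncomputable def vTwo {n : ℕ} (F : ℂ → Fin n → ℂ) (z : ℂ) : Fin (n + 2) → ℂ :=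
  Fin.cons 0 (Fin.cons 1 (F z))

def IsPolyMap {n : ℕ} (F : ℂ → Fin n → ℂ) : Prop :=
  ∀ i : Fin n, ∃ p : Polynomial ℂ, ∀ z : ℂ, F z i = Polynomial.eval z p

def CondA {n : ℕ} (d : ℕ) (F₁ F₂ : ℂ → Fin n → ℂ) : Prop :=
  ∀ z : ℂ,
    1 + hinner (F₁ z) (F₁ z) + hinner (F₂ z) (F₂ z) +
      (hinner (F₁ z) (F₁ z) * hinner (F₂ z) (F₂ z) -
        hinner (F₁ z) (F₂ z) * (starRingEnd ℂ) (hinner (F₁ z) (F₂ z))) =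
    (1 + (Complex.normSq z : ℂ)) ^ d

def CondB {n : ℕ} (d : ℕ) (c : ℝ) (F₁ F₂ : ℂ → Fin n → ℂ) : Prop :=
  ∀ z : ℂ,
    gram ![vOne F₁ z, vTwo F₂ z, deriv (vOne F₁) z, deriv (vTwo F₂) z] =
      (c : ℂ) * (1 + (Complex.normSq z : ℂ)) ^ (2 * d - 4)

noncomputable def F1t (t : ℝ) (z : ℂ) : Fin 4 → ℂ :=
  ![(|t - 2| : ℝ) * z ^ 3, (Real.sqrt t : ℝ) * z,
    ((Real.sqrt ((3 - t) / (4 - t)) * |t - 2| : ℝ)) * z ^ 2,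
    ((Real.sqrt (t / (4 - t)) : ℝ)) * z ^ 2]

noncomputable def F2t (t : ℝ) (z : ℂ) : Fin 4 → ℂ :=
  ![(Real.sqrt (3 - t) : ℝ) * z ^ 2, 0, (Real.sqrt (4 - t) : ℝ) * z, 0]

noncomputable def v1t (t : ℝ) (z : ℂ) : Fin 6 → ℂ := vOne (F1t t) z

noncomputable def v2t (t : ℝ) (z : ℂ) : Fin 6 → ℂ := vTwo (F2t t) z

noncomputable def pad4 {n : ℕ} (v : Fin 4 → ℂ) : Fin n → ℂ :=
  fun j => if h : (j : ℕ) < 4 then v ⟨(j : ℕ), h⟩ else 0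

section helpers

lemma hinner_add_left {m : ℕ} (u v w : Fin m → ℂ) : hinner (u + v) w = hinner u w + hinner v w := by
  simp [hinner, add_mul, Finset.sum_add_distrib]
lemma hinner_add_right {m : ℕ} (u v w : Fin m → ℂ) : hinner u (v + w) = hinner u v + hinner u w := by
  simp [hinner, mul_add, Finset.sum_add_distrib]
lemma hinner_smul_left {m : ℕ} (a : ℂ) (u w : Fin m → ℂ) : hinner (a • u) w = a * hinner u w := by
  simp [hinner, Finset.mul_sum, mul_assoc]
lemma hinner_smul_right {m : ℕ} (a : ℂ) (u w : Fin m → ℂ) :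
    hinner u (a • w) = (starRingEnd ℂ) a * hinner u w := by
  simp only [hinner, Finset.mul_sum, Pi.smul_apply, smul_eq_mul, map_mul]
  exact Finset.sum_congr rfl fun i _ => by ring
lemma hinner_conj {m : ℕ} (u w : Fin m → ℂ) : (starRingEnd ℂ) (hinner u w) = hinner w u := by
  simp only [hinner, map_sum, map_mul, Complex.conj_conj]
  exact Finset.sum_congr rfl fun i _ => by ring
lemma hinner_zero_left {m : ℕ} (w : Fin m → ℂ) : hinner 0 w = 0 := by simp [hinner]
lemma hinner_zero_right {m : ℕ} (w : Fin m → ℂ) : hinner w 0 = 0 := by simp [hinner]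
lemma hinner_self {m : ℕ} (u : Fin m → ℂ) : hinner u u = ((∑ i, Complex.normSq (u i) : ℝ) : ℂ) := by
  simp [hinner, Complex.mul_conj]
lemma hinner_self_eq_zero {m : ℕ} {u : Fin m → ℂ} (h : hinner u u = 0) : u = 0 := by
  rw [hinner_self] at h
  have h' : (∑ i, Complex.normSq (u i) : ℝ) = 0 := by exact_mod_cast h
  rw [Finset.sum_eq_zero_iff_of_nonneg (fun i _ => Complex.normSq_nonneg _)] at h'
  funext i
  simpa using h' i (Finset.mem_univ i)
lemma hinner_self_real {m : ℕ} (u : Fin m → ℂ) : ∃ r : ℝ, 0 ≤ r ∧ hinner u u = (r : ℂ) :=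
  ⟨_, Finset.sum_nonneg fun _ _ => Complex.normSq_nonneg _, hinner_self u⟩

lemma hinner_dep {m : ℕ} {u v : Fin m → ℂ} (hu : u ≠ 0)
    (h : hinner u u * hinner v v - hinner u v * hinner v u = 0) :
    v = (hinner v u / hinner u u) • u := by
  have h0 : hinner u u ≠ 0 := fun h => hu (hinner_self_eq_zero h)
  have : v + (-(hinner v u / hinner u u)) • u = 0 := by
    apply hinner_self_eq_zero
    simp only [hinner_add_left, hinner_add_right, hinner_smul_left, hinner_smul_right, map_neg,
      map_div₀, hinner_conj]
    field_simp
    linear_combination h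
  rw [neg_smul] at this
  exact eq_of_sub_eq_zero (by rw [sub_eq_add_neg]; exact this)

lemma extract {N : ℕ} (c : Fin N → Fin N → ℂ)
    (h : ∀ z : ℂ, ∑ k, ∑ l, c k l * z ^ (k : ℕ) * (starRingEnd ℂ z) ^ (l : ℕ) = 0) :
    ∀ k l, c k l = 0 := by
  have key : ∀ p : Polynomial ℂ, (∀ x : ℝ, p.eval (x : ℂ) = 0) → p = 0 := by
    intro p hp
    apply Polynomial.eq_zero_of_infinite_isRoot
    exact (Set.infinite_range_of_injective Complex.ofReal_injective).mono
      (by rintro _ ⟨x, rfl⟩; exact hp x)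
  have h1 : ∀ a : ℂ, ∀ b : ℝ,
      ∑ k, ∑ l, c k l * (a + b * I) ^ (k : ℕ) * (a - b * I) ^ (l : ℕ) = 0 := by
    intro a b
    have := key (∑ k, ∑ l, Polynomial.C (c k l) * (Polynomial.X + Polynomial.C (b * I)) ^ (k : ℕ) *
      (Polynomial.X - Polynomial.C (b * I)) ^ (l : ℕ)) (by
        intro x
        have := h (x + b * I)
        simpa [Polynomial.eval_finsetSum, sub_eq_add_neg] using this)
    have := congrArg (Polynomial.eval a) this
    simpa [Polynomial.eval_finsetSum] using this
  have h2 : ∀ a b : ℂ,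
      ∑ k, ∑ l, c k l * (a + b * I) ^ (k : ℕ) * (a - b * I) ^ (l : ℕ) = 0 := by
    intro a b
    have := key (∑ k, ∑ l, Polynomial.C (c k l) *
      (Polynomial.C a + Polynomial.X * Polynomial.C I) ^ (k : ℕ) *
      (Polynomial.C a - Polynomial.X * Polynomial.C I) ^ (l : ℕ)) (by
        intro x
        have := h1 a x
        simpa [Polynomial.eval_finsetSum, mul_comm I] using this)
    have := congrArg (Polynomial.eval b) this
    simpa [Polynomial.eval_finsetSum, mul_comm I] using this
  have h3 : ∀ z w : ℂ, ∑ k, ∑ l, c k l * z ^ (k : ℕ) * w ^ (l : ℕ) = 0 := by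
    intro z w
    have := h2 ((z + w) / 2) (-(z - w) / 2 * I)
    have e1 : (z + w) / 2 + -(z - w) / 2 * I * I = z := by
      linear_combination (-(z - w) / 2) * I_mul_I
    have e2 : (z + w) / 2 - -(z - w) / 2 * I * I = w := by
      linear_combination ((z - w) / 2) * I_mul_I
    rwa [e1, e2] at this
  have single : ∀ d : Fin N → ℂ, (∀ z : ℂ, ∑ k, d k * z ^ (k : ℕ) = 0) → ∀ k, d k = 0 := by
    intro d hd k
    have := key (∑ k, Polynomial.C (d k) * Polynomial.X ^ (k : ℕ)) (by
      intro x; simpa [Polynomial.eval_finsetSum] using hd x)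
    have := congrArg (fun p => Polynomial.coeff p (k : ℕ)) this
    simpa [Polynomial.finsetSum_coeff, Polynomial.coeff_C_mul, Polynomial.coeff_X_pow,
      Fin.val_inj] using this
  intro k l
  have h4 : ∀ w : ℂ, ∀ k, ∑ l, c k l * w ^ (l : ℕ) = 0 := by
    intro w
    apply single
    intro z
    rw [← h3 z w]
    refine Finset.sum_congr rfl fun k _ => ?_
    rw [Finset.sum_mul]
    exact Finset.sum_congr rfl fun l _ => by ring
  exact single (fun l => c k l) (fun w => h4 w k) l

lemma hinner_cons {m : ℕ} (a b : ℂ) (u v : Fin m → ℂ) :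
    hinner (Fin.cons a u : Fin (m + 1) → ℂ) (Fin.cons b v) = a * (starRingEnd ℂ) b + hinner u v := by
  simp [hinner, Fin.sum_univ_succ]

noncomputable def MB {n : ℕ} (A B D E : Fin n → ℂ) : Matrix (Fin 4) (Fin 4) ℂ :=
  !![1 + hinner A A, hinner A B, hinner A D, hinner A E;
     hinner B A, 1 + hinner B B, hinner B D, hinner B E;
     hinner D A, hinner D B, hinner D D, hinner D E;
     hinner E A, hinner E B, hinner E D, hinner E E]

noncomputable def MA {n : ℕ} (A B : Fin n → ℂ) : ℂ :=
  (1 + hinner A A) * (1 + hinner B B) - hinner A B * hinner B A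

lemma deriv_cubic {n : ℕ} (x p q : Fin n → ℂ) (z : ℂ) :
    HasDerivAt (fun z : ℂ => z • x + z ^ 2 • p + z ^ 3 • q)
      (x + (2 * z) • p + (3 * z ^ 2) • q) z := by
  rw [hasDerivAt_pi]
  intro i
  have h1 := (hasDerivAt_id z).mul_const (x i)
  have h2 := (hasDerivAt_pow 2 z).mul_const (p i)
  have h3 := (hasDerivAt_pow 3 z).mul_const (q i)
  have := (h1.add h2).add h3
  refine this.congr_deriv ?_
  simp

lemma deriv_vOne {n : ℕ} (F : ℂ → Fin n → ℂ) (F' : Fin n → ℂ) (z : ℂ) (h : HasDerivAt F F' z) :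
    deriv (vOne F) z = Fin.cons 0 (Fin.cons 0 F') := by
  apply HasDerivAt.deriv
  rw [hasDerivAt_pi] at h ⊢
  intro i
  refine Fin.cases ?_ (fun i => Fin.cases ?_ (fun i => ?_) i) i
  · simpa [vOne] using hasDerivAt_const z (1 : ℂ)
  · simpa [vOne] using hasDerivAt_const z (0 : ℂ)
  · simpa [vOne] using h i

lemma deriv_vTwo {n : ℕ} (F : ℂ → Fin n → ℂ) (F' : Fin n → ℂ) (z : ℂ) (h : HasDerivAt F F' z) :
    deriv (vTwo F) z = Fin.cons 0 (Fin.cons 0 F') := by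
  apply HasDerivAt.deriv
  rw [hasDerivAt_pi] at h ⊢
  intro i
  refine Fin.cases ?_ (fun i => Fin.cases ?_ (fun i => ?_) i) i
  · simpa [vTwo] using hasDerivAt_const z (0 : ℂ)
  · simpa [vTwo] using hasDerivAt_const z (1 : ℂ)
  · simpa [vTwo] using h i

lemma condB_MB {n : ℕ} {c : ℝ} (x p q y r u : Fin n → ℂ)
    (h : CondB 4 c (fun z => z • x + z ^ 2 • p + z ^ 3 • q)
      (fun z => z • y + z ^ 2 • r + z ^ 3 • u)) (z : ℂ) :
    (MB (z • x + z ^ 2 • p + z ^ 3 • q) (z • y + z ^ 2 • r + z ^ 3 • u)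
      (x + (2 * z) • p + (3 * z ^ 2) • q) (y + (2 * z) • r + (3 * z ^ 2) • u)).det =
      c * (1 + z * (starRingEnd ℂ) z) ^ 4 := by
  have := h z
  rw [deriv_vOne _ _ z (deriv_cubic x p q z), deriv_vTwo _ _ z (deriv_cubic y r u z)] at this
  rw [Complex.mul_conj]
  refine Eq.trans ?_ this
  unfold gram
  congr 1
  ext i j
  fin_cases i <;> fin_cases j <;> simp [MB, vOne, vTwo, hinner_cons]

lemma condA_MA {n : ℕ} (x p q y r u : Fin n → ℂ)
    (h : CondA 4 (fun z => z • x + z ^ 2 • p + z ^ 3 • q)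
      (fun z => z • y + z ^ 2 • r + z ^ 3 • u)) (z : ℂ) :
    MA (z • x + z ^ 2 • p + z ^ 3 • q) (z • y + z ^ 2 • r + z ^ 3 • u) =
      (1 + z * (starRingEnd ℂ) z) ^ 4 := by
  have := h z
  simp only [hinner_conj] at this
  rw [Complex.mul_conj, ← this]
  unfold MA
  ring

lemma MA_rot {n : ℕ} (A B : Fin n → ℂ) (a b c d : ℂ)
    (hu : !![a, b; c, d] ∈ Matrix.unitaryGroup (Fin 2) ℂ) :
    MA (a • A + b • B) (c • A + d • B) = MA A B := by
  have h := Matrix.mem_unitaryGroup_iff.1 hu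
  have h00 := congrFun (congrFun h 0) 0
  have h01 := congrFun (congrFun h 0) 1
  have h10 := congrFun (congrFun h 1) 0
  have h11 := congrFun (congrFun h 1) 1
  simp [Matrix.mul_apply, Fin.sum_univ_two, Matrix.star_apply] at h00 h01 h10 h11
  have e : ∀ A B : Fin n → ℂ, MA A B = (!![1 + hinner A A, hinner A B; hinner B A, 1 + hinner B B]).det := by
    intro A B; simp [MA, Matrix.det_fin_two]
  have e2 : !![1 + hinner (a • A + b • B) (a • A + b • B), hinner (a • A + b • B) (c • A + d • B);
      hinner (c • A + d • B) (a • A + b • B), 1 + hinner (c • A + d • B) (c • A + d • B)] =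
      !![a, b; c, d] * !![1 + hinner A A, hinner A B; hinner B A, 1 + hinner B B] *
        star !![a, b; c, d] := by
    ext i j
    fin_cases i <;> fin_cases j <;>
      simp [Matrix.mul_apply, Fin.sum_univ_two, Matrix.star_apply, hinner_add_left,
        hinner_add_right, hinner_smul_left, hinner_smul_right]
    · linear_combination -h00
    · linear_combination -h01
    · linear_combination -h10
    · linear_combination -h11
  rw [e, e, e2, Matrix.det_mul, Matrix.det_mul, mul_right_comm, ← Matrix.det_mul, h]
  simp

lemma MB_rot {n : ℕ} (A B D E : Fin n → ℂ) (a b c d : ℂ)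
    (hu : !![a, b; c, d] ∈ Matrix.unitaryGroup (Fin 2) ℂ) :
    (MB (a • A + b • B) (c • A + d • B) (a • D + b • E) (c • D + d • E)).det = (MB A B D E).det := by
  have h := Matrix.mem_unitaryGroup_iff.1 hu
  have h00 := congrFun (congrFun h 0) 0
  have h01 := congrFun (congrFun h 0) 1
  have h10 := congrFun (congrFun h 1) 0
  have h11 := congrFun (congrFun h 1) 1
  simp [Matrix.mul_apply, Fin.sum_univ_two, Matrix.star_apply] at h00 h01 h10 h11
  have hW : !![a, b, 0, 0; c, d, 0, 0; 0, 0, a, b; 0, 0, c, d] *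
      star !![a, b, 0, 0; c, d, 0, 0; 0, 0, a, b; 0, 0, c, d] = 1 := by
    ext i j
    fin_cases i <;> fin_cases j <;>
      simp [Matrix.mul_apply, Fin.sum_univ_four, Matrix.star_apply, h00, h01, h10, h11]
  have e2 : MB (a • A + b • B) (c • A + d • B) (a • D + b • E) (c • D + d • E) =
      !![a, b, 0, 0; c, d, 0, 0; 0, 0, a, b; 0, 0, c, d] * MB A B D E *
        star !![a, b, 0, 0; c, d, 0, 0; 0, 0, a, b; 0, 0, c, d] := by
    ext i j
    fin_cases i <;> fin_cases j <;>
      simp [MB, Matrix.mul_apply, Fin.sum_univ_four, Matrix.star_apply, hinner_add_left,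
        hinner_add_right, hinner_smul_left, hinner_smul_right] <;>
      first
      | ring1
      | linear_combination -h00
      | linear_combination -h01
      | linear_combination -h10
      | linear_combination -h11
  rw [e2, Matrix.det_mul, Matrix.det_mul, mul_right_comm, ← Matrix.det_mul, hW]
  simp

set_option maxRecDepth 100000 in
lemma extractA {n : ℕ} (x p q y r u : Fin n → ℂ)
    (h : ∀ z : ℂ, MA (z • x + z ^ 2 • p + z ^ 3 • q) (z • y + z ^ 2 • r + z ^ 3 • u) =
      (1 + z * (starRingEnd ℂ) z) ^ 4) :
    ( - 4 + hinner x x + hinner y y = 0) ∧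
    ( - 6 + hinner p p + hinner r r + hinner x x*hinner y y - hinner x y*hinner y x = 0) ∧
    ( - 4 + hinner p p*hinner y y - hinner p r*hinner y x + hinner p x*hinner y r - hinner p y*hinner y p + hinner q q - hinner r p*hinner x y + hinner r r*hinner x x - hinner r x*hinner x r + hinner r y*hinner x p + hinner u u = 0) ∧
    ( - 1 + hinner p p*hinner r r + hinner p q*hinner r y - hinner p r*hinner r p - hinner p u*hinner r x + hinner p x*hinner r u - hinner p y*hinner r q + hinner q p*hinner y r + hinner q q*hinner y y - hinner q r*hinner y p - hinner q u*hinner y x + hinner q x*hinner y u - hinner q y*hinner y q - hinner u p*hinner x r - hinner u q*hinner x y + hinner u r*hinner x p + hinner u u*hinner x x - hinner u x*hinner x u + hinner u y*hinner x q = 0) ∧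
    (hinner p p*hinner u u + hinner p q*hinner u r - hinner p r*hinner u q - hinner p u*hinner u p + hinner q p*hinner r u + hinner q q*hinner r r - hinner q r*hinner r q - hinner q u*hinner r p = 0) ∧
    (hinner q q*hinner u u - hinner q u*hinner u q = 0) ∧
    (hinner x p + hinner y r = 0) ∧
    (hinner x q + hinner y u = 0) ∧
    (hinner p q + hinner r u + hinner x p*hinner y y - hinner x r*hinner y x + hinner x x*hinner y r - hinner x y*hinner y p = 0) ∧
    (hinner x p*hinner y r + hinner x q*hinner y y - hinner x r*hinner y p - hinner x u*hinner y x + hinner x x*hinner y u - hinner x y*hinner y q = 0) ∧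
    (hinner p p*hinner y r + hinner p q*hinner y y - hinner p r*hinner y p - hinner p u*hinner y x + hinner p x*hinner y u - hinner p y*hinner y q - hinner r p*hinner x r - hinner r q*hinner x y + hinner r r*hinner x p + hinner r u*hinner x x - hinner r x*hinner x u + hinner r y*hinner x q = 0) := by
  have key := extract (N := 7) ![
    ![0,
      0,
      0,
      0,
      0,
      0,
      0],
    ![0,
       - 4 + hinner x x + hinner y y,
      hinner x p + hinner y r,
      hinner x q + hinner y u,
      0,
      0,
      0],
    ![0,
      hinner p x + hinner r y,
       - 6 + hinner p p + hinner r r + hinner x x*hinner y y - hinner x y*hinner y x,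
      hinner p q + hinner r u + hinner x p*hinner y y - hinner x r*hinner y x + hinner x x*hinner y r - hinner x y*hinner y p,
      hinner x p*hinner y r + hinner x q*hinner y y - hinner x r*hinner y p - hinner x u*hinner y x + hinner x x*hinner y u - hinner x y*hinner y q,
      hinner x p*hinner y u + hinner x q*hinner y r - hinner x r*hinner y q - hinner x u*hinner y p,
      hinner x q*hinner y u - hinner x u*hinner y q],
    ![0,
      hinner q x + hinner u y,
      hinner p x*hinner y y - hinner p y*hinner y x + hinner q p - hinner r x*hinner x y + hinner r y*hinner x x + hinner u r,
       - 4 + hinner p p*hinner y y - hinner p r*hinner y x + hinner p x*hinner y r - hinner p y*hinner y p + hinner q q - hinner r p*hinner x y + hinner r r*hinner x x - hinner r x*hinner x r + hinner r y*hinner x p + hinner u u,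
      hinner p p*hinner y r + hinner p q*hinner y y - hinner p r*hinner y p - hinner p u*hinner y x + hinner p x*hinner y u - hinner p y*hinner y q - hinner r p*hinner x r - hinner r q*hinner x y + hinner r r*hinner x p + hinner r u*hinner x x - hinner r x*hinner x u + hinner r y*hinner x q,
      hinner p p*hinner y u + hinner p q*hinner y r - hinner p r*hinner y q - hinner p u*hinner y p - hinner r p*hinner x u - hinner r q*hinner x r + hinner r r*hinner x q + hinner r u*hinner x p,
      hinner p q*hinner y u - hinner p u*hinner y q - hinner r q*hinner x u + hinner r u*hinner x q],
    ![0,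
      0,
      hinner p x*hinner r y - hinner p y*hinner r x + hinner q x*hinner y y - hinner q y*hinner y x - hinner u x*hinner x y + hinner u y*hinner x x,
      hinner p p*hinner r y - hinner p r*hinner r x + hinner p x*hinner r r - hinner p y*hinner r p + hinner q p*hinner y y - hinner q r*hinner y x + hinner q x*hinner y r - hinner q y*hinner y p - hinner u p*hinner x y + hinner u r*hinner x x - hinner u x*hinner x r + hinner u y*hinner x p,
       - 1 + hinner p p*hinner r r + hinner p q*hinner r y - hinner p r*hinner r p - hinner p u*hinner r x + hinner p x*hinner r u - hinner p y*hinner r q + hinner q p*hinner y r + hinner q q*hinner y y - hinner q r*hinner y p - hinner q u*hinner y x + hinner q x*hinner y u - hinner q y*hinner y q - hinner u p*hinner x r - hinner u q*hinner x y + hinner u r*hinner x p + hinner u u*hinner x x - hinner u x*hinner x u + hinner u y*hinner x q,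
      hinner p p*hinner r u + hinner p q*hinner r r - hinner p r*hinner r q - hinner p u*hinner r p + hinner q p*hinner y u + hinner q q*hinner y r - hinner q r*hinner y q - hinner q u*hinner y p - hinner u p*hinner x u - hinner u q*hinner x r + hinner u r*hinner x q + hinner u u*hinner x p,
      hinner p q*hinner r u - hinner p u*hinner r q + hinner q q*hinner y u - hinner q u*hinner y q - hinner u q*hinner x u + hinner u u*hinner x q],
    ![0,
      0,
      hinner p x*hinner u y - hinner p y*hinner u x + hinner q x*hinner r y - hinner q y*hinner r x,
      hinner p p*hinner u y - hinner p r*hinner u x + hinner p x*hinner u r - hinner p y*hinner u p + hinner q p*hinner r y - hinner q r*hinner r x + hinner q x*hinner r r - hinner q y*hinner r p,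
      hinner p p*hinner u r + hinner p q*hinner u y - hinner p r*hinner u p - hinner p u*hinner u x + hinner p x*hinner u u - hinner p y*hinner u q + hinner q p*hinner r r + hinner q q*hinner r y - hinner q r*hinner r p - hinner q u*hinner r x + hinner q x*hinner r u - hinner q y*hinner r q,
      hinner p p*hinner u u + hinner p q*hinner u r - hinner p r*hinner u q - hinner p u*hinner u p + hinner q p*hinner r u + hinner q q*hinner r r - hinner q r*hinner r q - hinner q u*hinner r p,
      hinner p q*hinner u u - hinner p u*hinner u q + hinner q q*hinner r u - hinner q u*hinner r q],
    ![0,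
      0,
      hinner q x*hinner u y - hinner q y*hinner u x,
      hinner q p*hinner u y - hinner q r*hinner u x + hinner q x*hinner u r - hinner q y*hinner u p,
      hinner q p*hinner u r + hinner q q*hinner u y - hinner q r*hinner u p - hinner q u*hinner u x + hinner q x*hinner u u - hinner q y*hinner u q,
      hinner q p*hinner u u + hinner q q*hinner u r - hinner q r*hinner u q - hinner q u*hinner u p,
      hinner q q*hinner u u - hinner q u*hinner u q]] (by
    intro z
    have hz := h z
    simp only [MA, hinner_add_left, hinner_add_right, hinner_smul_left, hinner_smul_right, map_pow] at hz
    simp only [Fin.sum_univ_seven, Matrix.cons_val, Fin.coe_ofNat_eq_mod, Nat.reduceMod]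
    generalize (starRingEnd ℂ) z = w at hz ⊢
    linear_combination (exp := 1) hz)
  have k0 := key 1 1
  have k1 := key 2 2
  have k2 := key 3 3
  have k3 := key 4 4
  have k4 := key 5 5
  have k5 := key 6 6
  have k6 := key 1 2
  have k7 := key 1 3
  have k8 := key 2 3
  have k9 := key 2 4
  have k10 := key 3 4
  simp only [Matrix.cons_val] at k0 k1 k2 k3 k4 k5 k6 k7 k8 k9 k10
  exact ⟨k0, k1, k2, k3, k4, k5, k6, k7, k8, k9, k10⟩

lemma MB_red {n : ℕ} (A B D E : Fin n → ℂ) (z : ℂ) :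
    (MB A B D E).det = (MB (A - z • D) (B - z • E) D E).det := by
  have e2 : MB (A - z • D) (B - z • E) D E =
      !![1, 0, -z, 0; 0, 1, 0, -z; 0, 0, 1, 0; 0, 0, 0, 1] * MB A B D E *
        star !![1, 0, -z, 0; 0, 1, 0, -z; 0, 0, 1, 0; 0, 0, 0, 1] := by
    simp only [sub_eq_add_neg, ← neg_smul]
    ext i j
    fin_cases i <;> fin_cases j <;>
      simp [-neg_smul, MB, Matrix.mul_apply, Fin.sum_univ_four, Matrix.star_apply, hinner_add_left,
        hinner_add_right, hinner_smul_left, hinner_smul_right] <;> ring1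
  have hd : (!![1, 0, -z, 0; 0, 1, 0, -z; 0, 0, 1, 0; 0, 0, 0, 1] : Matrix (Fin 4) (Fin 4) ℂ).det = 1 := by
    simp [Matrix.det_succ_row_zero, Fin.sum_univ_succ, Fin.succAbove]
  rw [e2, Matrix.det_mul, Matrix.det_mul, Matrix.star_eq_conjTranspose, Matrix.det_conjTranspose, hd]
  simp

lemma det_four (a : Matrix (Fin 4) (Fin 4) ℂ) : a.det = 
    (a 0 0 * a 1 1 - a 0 1 * a 1 0) * (a 2 2 * a 3 3 - a 2 3 * a 3 2)
    - (a 0 0 * a 1 2 - a 0 2 * a 1 0) * (a 2 1 * a 3 3 - a 2 3 * a 3 1)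
    + (a 0 0 * a 1 3 - a 0 3 * a 1 0) * (a 2 1 * a 3 2 - a 2 2 * a 3 1)
    + (a 0 1 * a 1 2 - a 0 2 * a 1 1) * (a 2 0 * a 3 3 - a 2 3 * a 3 0)
    - (a 0 1 * a 1 3 - a 0 3 * a 1 1) * (a 2 0 * a 3 2 - a 2 2 * a 3 0)
    + (a 0 2 * a 1 3 - a 0 3 * a 1 2) * (a 2 0 * a 3 1 - a 2 1 * a 3 0) := by
  simp [Matrix.det_succ_row_zero, Fin.sum_univ_succ, Fin.succAbove]
  ring

lemma det_MB {n : ℕ} (A B D E : Fin n → ℂ) : (MB A B D E).det =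
    ((1 + hinner A A) * (1 + hinner B B) - hinner A B * hinner B A) * (hinner D D * hinner E E - hinner D E * hinner E D)
    - ((1 + hinner A A) * hinner B D - hinner A D * hinner B A) * (hinner D B * hinner E E - hinner D E * hinner E B)
    + ((1 + hinner A A) * hinner B E - hinner A E * hinner B A) * (hinner D B * hinner E D - hinner D D * hinner E B)
    + (hinner A B * hinner B D - hinner A D * (1 + hinner B B)) * (hinner D A * hinner E E - hinner D E * hinner E A)
    - (hinner A B * hinner B E - hinner A E * (1 + hinner B B)) * (hinner D A * hinner E D - hinner D D * hinner E A)
    + (hinner A D * hinner B E - hinner A E * hinner B D) * (hinner D A * hinner E B - hinner D B * hinner E A) := by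
  rw [det_four]
  simp [MB]

set_option maxRecDepth 100000 in
lemma extractB {n : ℕ} (x p y e : Fin n → ℂ) (s m c : ℝ)
    (hxe : hinner x e = 0) (hex : hinner e x = 0) (hee : hinner e e = 1)
    (h : ∀ z : ℂ, (MB (z • x + z ^ 2 • p + z ^ 3 • ((s : ℂ) • e))
        (z • y + z ^ 2 • ((m : ℂ) • e) + z ^ 3 • (0 : Fin n → ℂ))
      (x + (2 * z) • p + (3 * z ^ 2) • ((s : ℂ) • e))
      (y + (2 * z) • ((m : ℂ) • e) + (3 * z ^ 2) • (0 : Fin n → ℂ))).det =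
      (c : ℂ) * (1 + z * (starRingEnd ℂ) z) ^ 4) :
    ( - (c : ℂ) + hinner x x*hinner y y - hinner x y*hinner y x = 0) ∧
    (2*(m : ℂ)*hinner x x*hinner y e + 2*hinner x p*hinner y y - 2*hinner x y*hinner y p = 0) ∧
    (4*(m : ℂ)*hinner x p*hinner y e - 3*(s : ℂ)*hinner x y*hinner y e = 0) ∧
    ( - 4*(c : ℂ) - 4*(m : ℂ)*hinner p e*hinner y x + 4*(m : ℂ)*hinner p x*hinner y e + 4*(m : ℂ)^2*hinner x x - 4*hinner e p*(m : ℂ)*hinner x y + 4*hinner e y*(m : ℂ)*hinner x p + 4*hinner p p*hinner y y - 4*hinner p y*hinner y p = 0) ∧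
    ( - 4*(c : ℂ) + 4*(m : ℂ)*(s : ℂ)*hinner x p*hinner y x - 4*(m : ℂ)*(s : ℂ)*hinner x x*hinner y p + 4*(m : ℂ)*hinner p x*(s : ℂ)*hinner x y - 4*(m : ℂ)*hinner p y*(s : ℂ)*hinner x x + 4*(m : ℂ)^2*hinner p p*hinner x x + 4*(m : ℂ)^2*hinner p p*hinner y y - 4*(m : ℂ)^2*hinner p x*hinner x p - 4*(m : ℂ)^2*hinner p y*hinner y p + 4*(s : ℂ)^2*hinner x x*hinner y y - 4*(s : ℂ)^2*hinner x y*hinner y x + 4*hinner e p*(m : ℂ)*(s : ℂ)*hinner x x*hinner y e - 4*hinner e p*(m : ℂ)^2*hinner p e*hinner x x - 4*hinner e p*(m : ℂ)^2*hinner p e*hinner y y + 4*hinner e p*(m : ℂ)^2*hinner p y*hinner y e + 4*hinner e y*(m : ℂ)*hinner p e*(s : ℂ)*hinner x x + 4*hinner e y*(m : ℂ)^2*hinner p e*hinner y p - 4*hinner e y*(m : ℂ)^2*hinner p p*hinner y e - 4*hinner e y*(s : ℂ)^2*hinner x x*hinner y e = 0) ∧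
    ( - (c : ℂ) + (m : ℂ)^2*hinner p p*hinner x x*hinner y y - (m : ℂ)^2*hinner p p*hinner x y*hinner y x - (m : ℂ)^2*hinner p x*hinner x p*hinner y y + (m : ℂ)^2*hinner p x*hinner x y*hinner y p + (m : ℂ)^2*hinner p y*hinner x p*hinner y x - (m : ℂ)^2*hinner p y*hinner x x*hinner y p - hinner e p*(m : ℂ)^2*hinner p e*hinner x x*hinner y y + hinner e p*(m : ℂ)^2*hinner p e*hinner x y*hinner y x - hinner e p*(m : ℂ)^2*hinner p x*hinner x y*hinner y e + hinner e p*(m : ℂ)^2*hinner p y*hinner x x*hinner y e - hinner e p*hinner p e*(s : ℂ)^2*hinner y y + hinner e p*hinner p y*(s : ℂ)^2*hinner y e - hinner e y*(m : ℂ)^2*hinner p e*hinner x p*hinner y x + hinner e y*(m : ℂ)^2*hinner p e*hinner x x*hinner y p - hinner e y*(m : ℂ)^2*hinner p p*hinner x x*hinner y e + hinner e y*(m : ℂ)^2*hinner p x*hinner x p*hinner y e + hinner e y*hinner p e*(s : ℂ)^2*hinner y p - hinner e y*hinner p p*(s : ℂ)^2*hinner y e + hinner p p*(s : ℂ)^2*hinner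 y y - hinner p y*(s : ℂ)^2*hinner y p = 0) := by
  have key := extract (N := 5) ![
    ![ - (c : ℂ) + hinner x x*hinner y y - hinner x y*hinner y x,
      2*(m : ℂ)*hinner x x*hinner y e + 2*hinner x p*hinner y y - 2*hinner x y*hinner y p,
      4*(m : ℂ)*hinner x p*hinner y e - 3*(s : ℂ)*hinner x y*hinner y e,
      0,
      0],
    ![2*hinner e y*(m : ℂ)*hinner x x + 2*hinner p x*hinner y y - 2*hinner p y*hinner y x,
       - 4*(c : ℂ) - 4*(m : ℂ)*hinner p e*hinner y x + 4*(m : ℂ)*hinner p x*hinner y e + 4*(m : ℂ)^2*hinner x x - 4*hinner e p*(m : ℂ)*hinner x y + 4*hinner e y*(m : ℂ)*hinner x p + 4*hinner p p*hinner y y - 4*hinner p y*hinner y p,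
       - 6*(m : ℂ)*(s : ℂ)*hinner x y - 8*(m : ℂ)*hinner p e*hinner y p + 8*(m : ℂ)*hinner p p*hinner y e + 8*(m : ℂ)^2*hinner x p + 6*hinner p e*(s : ℂ)*hinner y y - 6*hinner p y*(s : ℂ)*hinner y e,
      0,
      0],
    ![4*hinner e y*(m : ℂ)*hinner p x - 3*hinner e y*(s : ℂ)*hinner y x,
       - 6*(m : ℂ)*(s : ℂ)*hinner y x + 8*(m : ℂ)^2*hinner p x - 8*hinner e p*(m : ℂ)*hinner p y + 6*hinner e p*(s : ℂ)*hinner y y + 8*hinner e y*(m : ℂ)*hinner p p - 6*hinner e y*(s : ℂ)*hinner y p,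
       - 6*(c : ℂ) - 12*(m : ℂ)*(s : ℂ)*hinner y p - 12*(m : ℂ)*hinner p y*(s : ℂ) + 16*(m : ℂ)^2*hinner p p + (m : ℂ)^2*hinner x x*hinner y y - (m : ℂ)^2*hinner x y*hinner y x + 9*(s : ℂ)^2*hinner y y + 12*hinner e p*(m : ℂ)*(s : ℂ)*hinner y e - 16*hinner e p*(m : ℂ)^2*hinner p e + 12*hinner e y*(m : ℂ)*hinner p e*(s : ℂ) - hinner e y*(m : ℂ)^2*hinner x x*hinner y e - 9*hinner e y*(s : ℂ)^2*hinner y e + hinner p p*hinner x x*hinner y y - hinner p p*hinner x y*hinner y x - hinner p x*hinner x p*hinner y y + hinner p x*hinner x y*hinner y p + hinner p y*hinner x p*hinner y x - hinner p y*hinner x x*hinner y p,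
      2*(m : ℂ)*hinner p e*hinner x p*hinner y x - 2*(m : ℂ)*hinner p e*hinner x x*hinner y p + 2*(m : ℂ)*hinner p p*hinner x x*hinner y e - 2*(m : ℂ)*hinner p x*hinner x p*hinner y e + 2*(m : ℂ)^2*hinner x p*hinner y y - 2*(m : ℂ)^2*hinner x y*hinner y p + 2*hinner e p*(m : ℂ)^2*hinner x y*hinner y e - 2*hinner e y*(m : ℂ)^2*hinner x p*hinner y e + 2*hinner p e*(s : ℂ)*hinner x x*hinner y y - 2*hinner p e*(s : ℂ)*hinner x y*hinner y x + 2*hinner p x*(s : ℂ)*hinner x y*hinner y e - 2*hinner p y*(s : ℂ)*hinner x x*hinner y e,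
      hinner p e*(s : ℂ)*hinner x p*hinner y y - hinner p e*(s : ℂ)*hinner x y*hinner y p + hinner p p*(s : ℂ)*hinner x y*hinner y e - hinner p y*(s : ℂ)*hinner x p*hinner y e],
    ![0,
      0,
      2*(m : ℂ)^2*hinner p x*hinner y y - 2*(m : ℂ)^2*hinner p y*hinner y x + 2*hinner e p*(m : ℂ)*hinner p x*hinner x y - 2*hinner e p*(m : ℂ)*hinner p y*hinner x x + 2*hinner e p*(s : ℂ)*hinner x x*hinner y y - 2*hinner e p*(s : ℂ)*hinner x y*hinner y x + 2*hinner e y*(m : ℂ)*hinner p p*hinner x x - 2*hinner e y*(m : ℂ)*hinner p x*hinner x p + 2*hinner e y*(m : ℂ)^2*hinner p e*hinner y x - 2*hinner e y*(m : ℂ)^2*hinner p x*hinner y e + 2*hinner e y*(s : ℂ)*hinner x p*hinner y x - 2*hinner e y*(s : ℂ)*hinner x x*hinner y p,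
       - 4*(c : ℂ) + 4*(m : ℂ)*(s : ℂ)*hinner x p*hinner y x - 4*(m : ℂ)*(s : ℂ)*hinner x x*hinner y p + 4*(m : ℂ)*hinner p x*(s : ℂ)*hinner x y - 4*(m : ℂ)*hinner p y*(s : ℂ)*hinner x x + 4*(m : ℂ)^2*hinner p p*hinner x x + 4*(m : ℂ)^2*hinner p p*hinner y y - 4*(m : ℂ)^2*hinner p x*hinner x p - 4*(m : ℂ)^2*hinner p y*hinner y p + 4*(s : ℂ)^2*hinner x x*hinner y y - 4*(s : ℂ)^2*hinner x y*hinner y x + 4*hinner e p*(m : ℂ)*(s : ℂ)*hinner x x*hinner y e - 4*hinner e p*(m : ℂ)^2*hinner p e*hinner x x - 4*hinner e p*(m : ℂ)^2*hinner p e*hinner y y + 4*hinner e p*(m : ℂ)^2*hinner p y*hinner y e + 4*hinner e y*(m : ℂ)*hinner p e*(s : ℂ)*hinner x x + 4*hinner e y*(m : ℂ)^2*hinner p e*hinner y p - 4*hinner e y*(m : ℂ)^2*hinner p p*hinner y e - 4*hinner e y*(s : ℂ)^2*hinner x x*hinner y e,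
      2*(m : ℂ)*hinner p p*(s : ℂ)*hinner x y - 2*(m : ℂ)*hinner p y*(s : ℂ)*hinner x p + 2*(s : ℂ)^2*hinner x p*hinner y y - 2*(s : ℂ)^2*hinner x y*hinner y p - 2*hinner e p*(m : ℂ)*hinner p e*(s : ℂ)*hinner x y + 2*hinner e p*(s : ℂ)^2*hinner x y*hinner y e + 2*hinner e y*(m : ℂ)*hinner p e*(s : ℂ)*hinner x p - 2*hinner e y*(s : ℂ)^2*hinner x p*hinner y e],
    ![0,
      0,
      hinner e p*hinner p x*(s : ℂ)*hinner y y - hinner e p*hinner p y*(s : ℂ)*hinner y x + hinner e y*hinner p p*(s : ℂ)*hinner y x - hinner e y*hinner p x*(s : ℂ)*hinner y p,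
      2*(m : ℂ)*hinner p p*(s : ℂ)*hinner y x - 2*(m : ℂ)*hinner p x*(s : ℂ)*hinner y p - 2*hinner e p*(m : ℂ)*hinner p e*(s : ℂ)*hinner y x + 2*hinner e p*(m : ℂ)*hinner p x*(s : ℂ)*hinner y e + 2*hinner e y*hinner p e*(s : ℂ)^2*hinner y x - 2*hinner e y*hinner p x*(s : ℂ)^2*hinner y e + 2*hinner p x*(s : ℂ)^2*hinner y y - 2*hinner p y*(s : ℂ)^2*hinner y x,
       - (c : ℂ) + (m : ℂ)^2*hinner p p*hinner x x*hinner y y - (m : ℂ)^2*hinner p p*hinner x y*hinner y x - (m : ℂ)^2*hinner p x*hinner x p*hinner y y + (m : ℂ)^2*hinner p x*hinner x y*hinner y p + (m : ℂ)^2*hinner p y*hinner x p*hinner y x - (m : ℂ)^2*hinner p y*hinner x x*hinner y p - hinner e p*(m : ℂ)^2*hinner p e*hinner x x*hinner y y + hinner e p*(m : ℂ)^2*hinner p e*hinner x y*hinner y x - hinner e p*(m : ℂ)^2*hinner p x*hinner x y*hinner y e + hinner e p*(m : ℂ)^2*hinner p y*hinner x x*hinner y e - hinner e p*hinner p e*(s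 : ℂ)^2*hinner y y + hinner e p*hinner p y*(s : ℂ)^2*hinner y e - hinner e y*(m : ℂ)^2*hinner p e*hinner x p*hinner y x + hinner e y*(m : ℂ)^2*hinner p e*hinner x x*hinner y p - hinner e y*(m : ℂ)^2*hinner p p*hinner x x*hinner y e + hinner e y*(m : ℂ)^2*hinner p x*hinner x p*hinner y e + hinner e y*hinner p e*(s : ℂ)^2*hinner y p - hinner e y*hinner p p*(s : ℂ)^2*hinner y e + hinner p p*(s : ℂ)^2*hinner y y - hinner p y*(s : ℂ)^2*hinner y p]] (by
    intro z
    have hz := h z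
    rw [MB_red _ _ _ _ z] at hz
    have e1 : z • x + z ^ 2 • p + z ^ 3 • ((s : ℂ) • e) - z • (x + (2 * z) • p + (3 * z ^ 2) • ((s : ℂ) • e))
        = (-z ^ 2) • p + (-2 * s * z ^ 3) • e := by module
    have e2 : z • y + z ^ 2 • ((m : ℂ) • e) + z ^ 3 • (0 : Fin n → ℂ) -
        z • (y + (2 * z) • ((m : ℂ) • e) + (3 * z ^ 2) • (0 : Fin n → ℂ))
        = (-m * z ^ 2) • e := by module
    have e3 : x + (2 * z) • p + (3 * z ^ 2) • ((s : ℂ) • e) = x + (2 * z) • p + (3 * z ^ 2 * s) • e := by module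
    have e4 : y + (2 * z) • ((m : ℂ) • e) + (3 * z ^ 2) • (0 : Fin n → ℂ) = y + (2 * z * m) • e := by module
    rw [e1, e2, e3, e4, det_MB] at hz
    simp only [hinner_add_left, hinner_add_right, hinner_smul_left, hinner_smul_right, map_pow, map_mul,
      map_neg, Complex.conj_ofReal, hxe, hex, hee, Complex.conj_ofNat, mul_zero, add_zero, zero_add] at hz
    simp only [Fin.sum_univ_five, Matrix.cons_val, Fin.coe_ofNat_eq_mod, Nat.reduceMod]
    generalize (starRingEnd ℂ) z = w at hz ⊢
    linear_combination (exp := 1) hz)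
  have k0 := key 0 0
  have k1 := key 0 1
  have k2 := key 0 2
  have k3 := key 1 1
  have k4 := key 3 3
  have k5 := key 4 4
  simp only [Matrix.cons_val] at k0 k1 k2 k3 k4 k5
  exact ⟨k0, k1, k2, k3, k4, k5⟩

lemma core_real (X Y P T K N s m c : ℝ) (hs : 0 < s) (hm : 0 ≤ m) (hc : 0 < c)
    (hX : 0 ≤ X) (hY : 0 ≤ Y) (hN : 0 ≤ N)
    (hmN : m = 0 ∨ N = 0)
    (a11 : X + Y = 4) (a22 : P + m ^ 2 + X * Y - N = 6)
    (a33 : P * Y - K + s ^ 2 + m ^ 2 * X = 4)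
    (a44 : s ^ 2 * Y + m ^ 2 * P - s * m * (2 * T) = 1)
    (b00 : c = X * Y - N)
    (b11 : c = m ^ 2 * X + P * Y - K)
    (b33 : c = - (m * s * X * (2 * T)) + m ^ 2 * P * X + m ^ 2 * (P * Y - K) + s ^ 2 * (X * Y - N))
    (b44 : c = m ^ 2 * (P * (X * Y - N) - K * X) + s ^ 2 * (P * Y - K)) :
    N = 0 ∧ 0 < X ∧ X ≤ 3 ∧ X ≠ 2 ∧ c = 4 * X - X ^ 2 ∧ s = |X - 2| ∧ m = √(3 - X) ∧
      Y = 4 - X ∧ P = X ^ 2 - 3 * X + 3 ∧ K = s ^ 2 * m ^ 2 ∧ (m = 0 ∨ T = s * m) := by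
  have hN0 : N = 0 := by
    rcases hmN with h | h
    · subst h
      have h1 : c * (s ^ 2 - 1) = 0 := by linear_combination s ^ 2 * b00 - b33
      have h2 : s ^ 2 = 1 := by
        rcases mul_eq_zero.1 h1 with h | h
        · exact absurd h hc.ne'
        · linarith
      have hY1 : Y = 1 := by nlinarith
      have hX3 : X = 3 := by linarith
      subst hY1 hX3
      linarith
    · exact h
  subst hN0
  have hY' : Y = 4 - X := by linarith
  have hX0 : 0 < X := by
    rcases hX.lt_or_eq with h | h
    · exact h
    · subst h; linarith
  have hc' : c = 4 * X - X ^ 2 := by rw [b00, hY']; ring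
  have hs2 : s ^ 2 = (X - 2) ^ 2 := by linear_combination a33 + b11 - hc'
  have hsX : s = |X - 2| := by
    rw [← abs_of_pos hs]; exact (sq_eq_sq_iff_abs_eq_abs _ _).1 hs2
  have hX2 : X ≠ 2 := by
    rintro rfl
    simp at hsX; exact hs.ne' hsX
  have h1 : X * ((m ^ 2 - 1) * (m ^ 2 - (3 - X))) = 0 := by
    subst hY'
    linear_combination b33 + X * a44 - (m ^ 2) * b11 - (1 - m ^ 2) * hc'
  have h2 : (c - m ^ 2 * X) * (s ^ 2 + m ^ 2 * X) = c := by
    linear_combination -b44 + (s ^ 2 + m ^ 2 * X) * b11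
  have hm2 : m ^ 2 = 3 - X := by
    rcases mul_eq_zero.1 h1 with h | h
    · exact absurd h hX0.ne'
    rcases mul_eq_zero.1 h with h | h
    · exfalso
      have hm1 : m ^ 2 = 1 := by linarith
      rw [hm1, hs2, hc'] at h2
      have h3 : X * (2 - X) ^ 3 = 0 := by linear_combination h2
      rcases mul_eq_zero.1 h3 with h | h
      · exact hX0.ne' h
      · exact hX2 (by linarith [pow_eq_zero_iff (three_ne_zero) |>.1 h])
    · linarith
  have hP : P = X ^ 2 - 3 * X + 3 := by subst hY'; linear_combination a22 - hm2
  have hK : K = s ^ 2 * m ^ 2 := by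
    rw [hs2, hm2]
    subst hY'
    linear_combination b11 - hc' + X * hm2 + (4 - X) * hP
  refine ⟨rfl, hX0, by nlinarith [sq_nonneg m], hX2, hc', hsX, ?_, hY', hP, hK, ?_⟩
  · rw [← hm2, Real.sqrt_sq hm]
  · by_cases h0 : m = 0
    · exact Or.inl h0
    · right
      have : (2 * (s * m)) * (T - s * m) = 0 := by
        subst hY'
        linear_combination -a44 + (4 - X - 2 * m ^ 2) * hs2 + m ^ 2 * hP + (X ^ 2 - 3 * X + 3 - 2 * (X - 2) ^ 2) * hm2
      rcases mul_eq_zero.1 this with h | h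
      · exfalso; exact mul_ne_zero two_ne_zero (mul_ne_zero hs.ne' h0) h
      · linarith

lemma core {n : ℕ} (x p y e : Fin n → ℂ) (s m c : ℝ) (hs : 0 < s) (hm : 0 ≤ m) (hc : 0 < c)
    (hee : hinner e e = 1)
    (hA : ∀ z : ℂ, MA (z • x + z ^ 2 • p + z ^ 3 • ((s : ℂ) • e))
        (z • y + z ^ 2 • ((m : ℂ) • e) + z ^ 3 • (0 : Fin n → ℂ)) =
      (1 + z * (starRingEnd ℂ) z) ^ 4)
    (hB : ∀ z : ℂ, (MB (z • x + z ^ 2 • p + z ^ 3 • ((s : ℂ) • e))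
        (z • y + z ^ 2 • ((m : ℂ) • e) + z ^ 3 • (0 : Fin n → ℂ))
      (x + (2 * z) • p + (3 * z ^ 2) • ((s : ℂ) • e))
      (y + (2 * z) • ((m : ℂ) • e) + (3 * z ^ 2) • (0 : Fin n → ℂ))).det =
      (c : ℂ) * (1 + z * (starRingEnd ℂ) z) ^ 4) :
    ∃ t : ℝ, 0 < t ∧ t ≤ 3 ∧ t ≠ 2 ∧ c = 4 * t - t ^ 2 ∧ s = |t - 2| ∧ m = √(3 - t) ∧
      hinner x x = t ∧ hinner y y = ((4 - t : ℝ) : ℂ) ∧ hinner p p = ((t ^ 2 - 3 * t + 3 : ℝ) : ℂ) ∧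
      hinner x y = 0 ∧ hinner x p = 0 ∧ hinner x e = 0 ∧ hinner y e = 0 ∧ hinner p e = 0 ∧
      hinner p y = ((s * m : ℝ) : ℂ) := by
  have hsC : (s : ℂ) ≠ 0 := by exact_mod_cast hs.ne'
  obtain ⟨a11, a22, a33, a44, -, -, a12, a13, a23, a24, a34⟩ := extractA _ _ _ _ _ _ hA
  simp only [hinner_smul_left, hinner_smul_right, hinner_zero_left, hinner_zero_right, hee,
    Complex.conj_ofReal, mul_zero, zero_mul, add_zero, zero_add, sub_zero, mul_one] at a11 a22 a33 a44 a12 a13 a23 a24 a34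
  have hxe : hinner x e = 0 := (mul_eq_zero.1 a13).resolve_left hsC
  have cj : ∀ {u v : Fin n → ℂ}, hinner u v = 0 → hinner v u = 0 := by
    intro u v h; rw [← hinner_conj, h, map_zero]
  have hex := cj hxe
  obtain ⟨b00, b01, b02, b11, b33, b44⟩ := extractB x p y e s m c hxe hex hee hB
  simp only [hxe] at a11 a22 a33 a44 a12 a23 a24 a34 b00 b01 b02 b11 b33 b44
  simp only [hex] at a11 a22 a33 a44 a12 a23 a24 a34 b00 b01 b02 b11 b33 b44
  have hpe : hinner p e = 0 := by
    have : (s : ℂ) * hinner p e = 0 := by linear_combination a23 - b01 / 2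
    exact (mul_eq_zero.1 this).resolve_left hsC
  have hep := cj hpe
  simp only [hpe] at a11 a22 a33 a44 a12 a23 a24 a34 b00 b01 b02 b11 b33 b44
  simp only [hep] at a11 a22 a33 a44 a12 a23 a24 a34 b00 b01 b02 b11 b33 b44
  obtain ⟨X, hX, eX⟩ := hinner_self_real x
  obtain ⟨Y, hY, eY⟩ := hinner_self_real y
  obtain ⟨P, hP, eP⟩ := hinner_self_real p
  simp only [eX] at a11 a22 a33 a44 a12 a23 a24 a34 b00 b01 b02 b11 b33 b44
  simp only [eY] at a11 a22 a33 a44 a12 a23 a24 a34 b00 b01 b02 b11 b33 b44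
  simp only [eP] at a11 a22 a33 a44 a12 a23 a24 a34 b00 b01 b02 b11 b33 b44
  have hye : hinner y e = 0 := by
    by_contra hne
    have h1 : (s : ℂ) * hinner x y = 0 := by
      apply (mul_eq_zero.1 (?_ : hinner y e * ((s : ℂ) * hinner x y) = 0)).resolve_left hne
      linear_combination b02 - 4 * a24
    have hxy : hinner x y = 0 := (mul_eq_zero.1 h1).resolve_left hsC
    have h2 : (m : ℂ) * hinner x p = 0 := by
      apply (mul_eq_zero.1 (?_ : hinner y e * ((m : ℂ) * hinner x p) = 0)).resolve_left hne
      linear_combination b02 / 4 + 3 / 4 * hinner y e * h1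
    have hm0 : (m : ℂ) = 0 := by
      have : hinner y e * ((m : ℂ) * m) = 0 := by linear_combination (m : ℂ) * a12 - h2
      rcases mul_eq_zero.1 this with h | h
      · exact absurd h hne
      · exact mul_self_eq_zero.1 h
    simp only [hm0] at a11 a22 a33 a44 a12 a23 a24 a34 b00 b01 b02 b11 b33 b44
    simp only [hxy] at a11 a22 a33 a44 a12 a23 a24 a34 b00 b01 b02 b11 b33 b44
    have hxp : hinner x p = 0 := by linear_combination a12
    have hpy : hinner p y = 0 := by
      have : (s : ℂ) * hinner y e * hinner p y = 0 := by linear_combination -a34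
      exact (mul_eq_zero.1 this).resolve_left (mul_ne_zero hsC hne)
    simp only [hpy] at a11 a22 a33 a44 a12 a23 a24 a34 b00 b01 b02 b11 b33 b44
    simp only [hxp] at a11 a22 a33 a44 a12 a23 a24 a34 b00 b01 b02 b11 b33 b44
    have q1 : (P : ℂ) = c := by linear_combination b44 - P * a44
    have q2 : (P : ℂ) + c = 6 := by linear_combination a22 - b00
    have hc3 : (c : ℂ) = 3 := by linear_combination q2 / 2 - q1 / 2
    have hY1 : (Y : ℂ) = 1 := by
      linear_combination b11 / 12 - (Y : ℂ) / 3 * q1 - ((Y : ℂ) - 1) / 3 * hc3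
    have hs1 : (s : ℂ) ^ 2 = 1 := by
      linear_combination a33 - b11 / 4 - hc3
    have : hinner e y * hinner y e = 0 := by
      linear_combination -a44 + hY1 + (Y - hinner e y * hinner y e) * hs1
    rcases mul_eq_zero.1 this with h | h
    · exact hne (cj h)
    · exact hne h
  have hey := cj hye
  simp only [hye] at a11 a22 a33 a44 a12 a23 a24 a34 b00 b01 b02 b11 b33 b44
  simp only [hey] at a11 a22 a33 a44 a12 a23 a24 a34 b00 b01 b02 b11 b33 b44
  have hxp : hinner x p = 0 := by linear_combination a12
  have hpx := cj hxp
  simp only [hxp] at a11 a22 a33 a44 a12 a23 a24 a34 b00 b01 b02 b11 b33 b44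
  simp only [hpx] at a11 a22 a33 a44 a12 a23 a24 a34 b00 b01 b02 b11 b33 b44
  have eyp : hinner y p = starRingEnd ℂ (hinner p y) := (hinner_conj _ _).symm
  have eyx : hinner y x = starRingEnd ℂ (hinner x y) := (hinner_conj _ _).symm
  simp only [eyp] at a11 a22 a33 a44 a12 a23 a24 a34 b00 b01 b02 b11 b33 b44
  simp only [eyx] at a11 a22 a33 a44 a12 a23 a24 a34 b00 b01 b02 b11 b33 b44
  have hmxy : (m : ℂ) = 0 ∨ hinner x y = 0 := by
    have : (s : ℂ) * ((m : ℂ) * hinner x y) = 0 := by linear_combination -a34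
    exact mul_eq_zero.1 ((mul_eq_zero.1 this).resolve_left hsC)
  have kK : hinner p y * starRingEnd ℂ (hinner p y) = (Complex.normSq (hinner p y) : ℂ) := Complex.mul_conj _
  have kN : hinner x y * starRingEnd ℂ (hinner x y) = (Complex.normSq (hinner x y) : ℂ) := Complex.mul_conj _
  have kT : hinner p y + starRingEnd ℂ (hinner p y) = ((2 * (hinner p y).re : ℝ) : ℂ) := Complex.add_conj _
  obtain ⟨r1, r2, r3, r4, r5, r6, r7, r8, r9, r10, r11⟩ := core_real X Y P (hinner p y).re (Complex.normSq (hinner p y)) (Complex.normSq (hinner x y)) s m c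
    hs hm hc hX hY (Complex.normSq_nonneg _)
    (by
      rcases hmxy with h | h
      · left; exact_mod_cast h
      · right; rw [h]; simp)
    (by
      apply Complex.ofReal_injective; push_cast
      linear_combination a11)
    (by
      apply Complex.ofReal_injective; push_cast
      linear_combination a22 + kN)
    (by
      apply Complex.ofReal_injective; push_cast
      linear_combination a33 + kK)
    (by
      apply Complex.ofReal_injective; push_cast at kT ⊢
      linear_combination a44 + s * m * kT)
    (by
      apply Complex.ofReal_injective; push_cast
      linear_combination -b00 - kN)
    (by
      apply Complex.ofReal_injective; push_cast
      linear_combination -b11 / 4 - kK)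
    (by
      apply Complex.ofReal_injective; push_cast at kT ⊢
      linear_combination -b33 / 4 - m * s * X * kT - m ^ 2 * kK - s ^ 2 * kN)
    (by
      apply Complex.ofReal_injective; push_cast
      linear_combination -b44 - m ^ 2 * P * kN - m ^ 2 * X * kK - s ^ 2 * kK)
  refine ⟨X, r2, r3, r4, r5, r6, r7, eX, by rw [eY, r8], by rw [eP, r9], Complex.normSq_eq_zero.1 r1, hxp, hxe, hye, hpe, ?_⟩
  rcases r11 with h | h
  · rw [h] at r10 ⊢
    simp at r10 ⊢
    exact r10
  · apply Complex.ext
    · simp [h]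
    · rw [Complex.normSq_apply, h] at r10
      have : (hinner p y).im * (hinner p y).im = 0 := by linear_combination r10
      simpa using this

lemma finish {n : ℕ} (x p y e : Fin n → ℂ) (s m t : ℝ)
    (t0 : 0 < t) (t3 : t ≤ 3) (hs : s = |t - 2|) (hm : m = √(3 - t))
    (hee : hinner e e = 1)
    (hxx : hinner x x = t) (hyy : hinner y y = ((4 - t : ℝ) : ℂ))
    (hpp : hinner p p = ((t ^ 2 - 3 * t + 3 : ℝ) : ℂ))
    (hxy : hinner x y = 0) (hxp : hinner x p = 0) (hxe : hinner x e = 0) (hye : hinner y e = 0)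
    (hpe : hinner p e = 0) (hpy : hinner p y = ((s * m : ℝ) : ℂ)) :
    4 ≤ n ∧ ∃ Q : Matrix (Fin n) (Fin n) ℂ, Q ∈ Matrix.unitaryGroup (Fin n) ℂ ∧
      ∀ z : ℂ, Matrix.of ![z • x + z ^ 2 • p + z ^ 3 • ((s : ℂ) • e),
          z • y + z ^ 2 • ((m : ℂ) • e) + z ^ 3 • (0 : Fin n → ℂ)] * Q =
        Matrix.of ![pad4 (F1t t z), pad4 (F2t t z)] := by
  have cj : ∀ {u v : Fin n → ℂ}, hinner u v = 0 → hinner v u = 0 := by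
    intro u v h; rw [← hinner_conj, h, map_zero]
  have hyx := cj hxy
  have hpx := cj hxp
  have hex := cj hxe
  have hey := cj hye
  have hep := cj hpe
  have hyp : hinner y p = ((s * m : ℝ) : ℂ) := by
    rw [← hinner_conj, hpy, Complex.conj_ofReal]
  have h4 : 0 < 4 - t := by linarith
  set α := √t with hα
  set β := √(4 - t) with hβ
  set γ := √(t / (4 - t)) with hγ
  have α2 : α ^ 2 = t := Real.sq_sqrt t0.le
  have β2 : β ^ 2 = 4 - t := Real.sq_sqrt h4.le
  have γ2 : γ ^ 2 = t / (4 - t) := Real.sq_sqrt (by positivity)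
  have α0 : α ≠ 0 := (Real.sqrt_pos.2 t0).ne'
  have β0 : β ≠ 0 := (Real.sqrt_pos.2 h4).ne'
  have γ0 : γ ≠ 0 := (Real.sqrt_pos.2 (by positivity)).ne'
  have m2 : m ^ 2 = 3 - t := by rw [hm]; exact Real.sq_sqrt (by linarith)
  have s2 : s ^ 2 = (t - 2) ^ 2 := by rw [hs, sq_abs]
  have hδ : √((3 - t) / (4 - t)) * |t - 2| = m * s / β := by
    rw [Real.sqrt_div (by linarith), ← hm, ← hs]; ring
  have hδ' : ((√((3 - t) / (4 - t)) : ℝ) : ℂ) * s = m * s / β := by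
    rw [← hs] at hδ; exact_mod_cast hδ
  have α0' : (α : ℂ) ≠ 0 := by exact_mod_cast α0
  have β0' : (β : ℂ) ≠ 0 := by exact_mod_cast β0
  have γ0' : (γ : ℂ) ≠ 0 := by exact_mod_cast γ0
  have α2' : (α : ℂ) ^ 2 = t := by exact_mod_cast α2
  have β2' : (β : ℂ) ^ 2 = 4 - t := by exact_mod_cast β2
  have m2' : (m : ℂ) ^ 2 = 3 - t := by exact_mod_cast m2
  have s2' : (s : ℂ) ^ 2 = (t - 2) ^ 2 := by exact_mod_cast s2
  have h4' : (4 - t : ℂ) ≠ 0 := by exact_mod_cast h4.ne'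
  have γ2' : (γ : ℂ) ^ 2 * (4 - t) = t := by
    have : γ ^ 2 * (4 - t) = t := by rw [γ2]; field_simp
    exact_mod_cast this
  -- the orthonormal family
  obtain ⟨f2, hf2⟩ : ∃ f : Fin n → ℂ, f = ((α⁻¹ : ℝ) : ℂ) • x := ⟨_, rfl⟩
  obtain ⟨f3, hf3⟩ : ∃ f : Fin n → ℂ, f = ((β⁻¹ : ℝ) : ℂ) • y := ⟨_, rfl⟩
  obtain ⟨f4, hf4⟩ : ∃ f : Fin n → ℂ, f = ((γ⁻¹ : ℝ) : ℂ) • (p + ((-(m * s / β ^ 2) : ℝ) : ℂ) • y) := ⟨_, rfl⟩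
  have ex : x = (α : ℂ) • f2 := by
    rw [hf2, smul_smul]; push_cast; rw [mul_inv_cancel₀ α0', one_smul]
  have ey : y = (β : ℂ) • f3 := by
    rw [hf3, smul_smul]; push_cast; rw [mul_inv_cancel₀ β0', one_smul]
  have ep : p = ((m * s / β : ℝ) : ℂ) • f3 + (γ : ℂ) • f4 := by
    rw [hf4, hf3, smul_smul, smul_smul]; push_cast; rw [mul_inv_cancel₀ γ0', one_smul]
    have : (m * s / β * (β : ℂ)⁻¹ : ℂ) = m * s / β ^ 2 := by field_simp
    rw [this]
    module
  have o12 : hinner e f2 = 0 := by rw [hf2, hinner_smul_right, hex, mul_zero]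
  have o13 : hinner e f3 = 0 := by rw [hf3, hinner_smul_right, hey, mul_zero]
  have o14 : hinner e f4 = 0 := by
    rw [hf4, hinner_smul_right, hinner_add_right, hinner_smul_right, hep, hey]; simp
  have o23 : hinner f2 f3 = 0 := by
    rw [hf2, hf3, hinner_smul_right, hinner_smul_left, hxy]; simp
  have o24 : hinner f2 f4 = 0 := by
    rw [hf2, hf4, hinner_smul_right, hinner_smul_left, hinner_add_right, hinner_smul_right, hxp, hxy]
    simp
  have o34 : hinner f3 f4 = 0 := by
    rw [hf3, hf4, hinner_smul_right, hinner_smul_left, hinner_add_right, hinner_smul_right, hyp, hyy,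
      Complex.conj_ofReal, Complex.conj_ofReal]
    push_cast
    rw [β2']
    field_simp
    ring
  have o22 : hinner f2 f2 = 1 := by
    rw [hf2, hinner_smul_right, hinner_smul_left, hxx, Complex.conj_ofReal]
    push_cast
    rw [← α2']
    field_simp
  have o33 : hinner f3 f3 = 1 := by
    rw [hf3, hinner_smul_right, hinner_smul_left, hyy, Complex.conj_ofReal]
    push_cast
    rw [← β2']
    field_simp
  have o44 : hinner f4 f4 = 1 := by
    rw [hf4, hinner_smul_right, hinner_smul_left, hinner_add_right, hinner_smul_right,
      hinner_add_left, hinner_smul_left, hinner_add_left, hinner_smul_left, hpp, hpy, hyp, hyy,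
      Complex.conj_ofReal, Complex.conj_ofReal]
    push_cast
    rw [β2']
    field_simp
    linear_combination -γ2' - m ^ 2 * s2' - (t - 2 : ℂ) ^ 2 * m2'
  -- Euclidean version
  let g : Fin 4 → Fin n → ℂ := ![e, f2, f3, f4]
  have hin : ∀ u v : Fin n → ℂ, inner ℂ (WithLp.toLp 2 u) (WithLp.toLp 2 v) = hinner v u := by
    intro u v
    simp [hinner, PiLp.inner_apply]
  have hg : ∀ i j, hinner (g i) (g j) = if i = j then 1 else 0 := by
    intro i j
    fin_cases i <;> fin_cases j <;> simp [g, hee, o12, o13, o14, o22, o23, o24, o33, o34, o44,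
      cj o12, cj o13, cj o14, cj o23, cj o24, cj o34]
  have hon : Orthonormal ℂ (fun i => (WithLp.toLp 2 (g i) : EuclideanSpace ℂ (Fin n))) := by
    rw [orthonormal_iff_ite]
    intro i j
    rw [hin, hg]
    simp [eq_comm]
  have hn4 : 4 ≤ n := by
    have := hon.linearIndependent.fintype_card_le_finrank
    simpa using this
  refine ⟨hn4, ?_⟩
  have hv : Orthonormal ℂ (Set.domRestrict {j : Fin n | (j : ℕ) < 4}
      (fun j : Fin n => if h : (j : ℕ) < 4 then
        (WithLp.toLp 2 (g ⟨j, h⟩) : EuclideanSpace ℂ (Fin n)) else 0)) := by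
    have := hon.comp (fun j : {j : Fin n | (j : ℕ) < 4} => (⟨j.1, j.2⟩ : Fin 4)) (by
      intro a b h
      apply Subtype.ext
      apply Fin.ext
      simpa using h)
    convert this using 1
    funext j
    have hj : ((j : Fin n) : ℕ) < 4 := j.2
    simp [Set.domRestrict, hj]
  obtain ⟨b, hb⟩ := hv.exists_orthonormalBasis_extension_of_card_eq (by simp)
  have hbb : ∀ i j, hinner (WithLp.ofLp (b i)) (WithLp.ofLp (b j)) = if i = j then 1 else 0 := by
    intro i j
    rw [← hin]
    have := orthonormal_iff_ite.1 b.orthonormal j i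
    simpa [eq_comm] using this
  have hbg : ∀ k : Fin 4, WithLp.ofLp (b ⟨k, by omega⟩) = g k := by
    intro k
    rw [hb ⟨k, by omega⟩ (by simp)]
    simp
  refine ⟨Matrix.of fun i j => starRingEnd ℂ (WithLp.ofLp (b j) i), ?_, ?_⟩
  · rw [Matrix.mem_unitaryGroup_iff']
    ext i j
    rw [Matrix.mul_apply, Matrix.one_apply]
    have := hbb i j
    unfold hinner at this
    simpa [Matrix.star_apply] using this
  · intro z
    have hE : ∀ (u v : Fin n → ℂ) (j : Fin n), (Matrix.of ![u, v] *
        Matrix.of fun i j => starRingEnd ℂ (WithLp.ofLp (b j) i)) 0 j = hinner u (WithLp.ofLp (b j)) := by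
      intro u v j
      simp [Matrix.mul_apply, hinner]
    have hE' : ∀ (u v : Fin n → ℂ) (j : Fin n), (Matrix.of ![u, v] *
        Matrix.of fun i j => starRingEnd ℂ (WithLp.ofLp (b j) i)) 1 j = hinner v (WithLp.ofLp (b j)) := by
      intro u v j
      simp [Matrix.mul_apply, hinner]
    have hgj : ∀ (k : Fin 4) (j : Fin n), hinner (g k) (WithLp.ofLp (b j)) = if (k : ℕ) = j then 1 else 0 := by
      intro k j
      rw [← hbg, hbb]
      simp [Fin.ext_iff]
    have g0 := hgj 0
    have g1 := hgj 1
    have g2 := hgj 2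
    have g3 := hgj 3
    simp only [g, Matrix.cons_val] at g0 g1 g2 g3
    ext i j
    fin_cases i
    · simp only [Fin.zero_eta]
      rw [hE, ex, ep]
      simp only [hinner_add_left, hinner_smul_left, g0, g1, g2, g3, Matrix.of_apply, Matrix.cons_val, pad4]
      by_cases hj : (j : ℕ) < 4
      · rw [dif_pos hj]
        obtain ⟨j, hjn⟩ := j
        simp only at hj
        interval_cases j <;> simp [F1t, ← hs, ← hα, ← hγ, mul_comm]
        left; linear_combination -hδ'
      · rw [dif_neg hj]
        have e0 : ¬ (0 = (j : ℕ)) := by omega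
        have e1 : ¬ (1 = (j : ℕ)) := by omega
        have e2 : ¬ (2 = (j : ℕ)) := by omega
        have e3 : ¬ (3 = (j : ℕ)) := by omega
        simp [e0, e1, e2, e3]
    · simp only [Fin.mk_one]
      rw [hE', ey]
      simp only [hinner_add_left, hinner_smul_left, hinner_zero_left, g0, g2, Matrix.of_apply, Matrix.cons_val, pad4]
      by_cases hj : (j : ℕ) < 4
      · rw [dif_pos hj]
        obtain ⟨j, hjn⟩ := j
        simp only at hj
        interval_cases j <;> simp [F2t, ← hm, ← hβ, mul_comm]
      · rw [dif_neg hj]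
        have e0 : ¬ (0 = (j : ℕ)) := by omega
        have e1 : ¬ (1 = (j : ℕ)) := by omega
        have e2 : ¬ (2 = (j : ℕ)) := by omega
        have e3 : ¬ (3 = (j : ℕ)) := by omega
        simp [e0, e1, e2, e3]

def Good {n : ℕ} (c : ℝ) (x p q y r u : Fin n → ℂ) : Prop :=
  (∀ z : ℂ, MA (z • x + z ^ 2 • p + z ^ 3 • q) (z • y + z ^ 2 • r + z ^ 3 • u) =
      (1 + z * (starRingEnd ℂ) z) ^ 4) ∧
  (∀ z : ℂ, (MB (z • x + z ^ 2 • p + z ^ 3 • q) (z • y + z ^ 2 • r + z ^ 3 • u)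
      (x + (2 * z) • p + (3 * z ^ 2) • q) (y + (2 * z) • r + (3 * z ^ 2) • u)).det =
      c * (1 + z * (starRingEnd ℂ) z) ^ 4)

lemma Good.rot {n : ℕ} {c₀ : ℝ} {x p q y r u : Fin n → ℂ} (h : Good c₀ x p q y r u) (a b c d : ℂ)
    (hu : !![a, b; c, d] ∈ Matrix.unitaryGroup (Fin 2) ℂ) :
    Good c₀ (a • x + b • y) (a • p + b • r) (a • q + b • u)
      (c • x + d • y) (c • p + d • r) (c • q + d • u) := by
  have e : ∀ (a b z : ℂ), z • (a • x + b • y) + z ^ 2 • (a • p + b • r) + z ^ 3 • (a • q + b • u) =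
      a • (z • x + z ^ 2 • p + z ^ 3 • q) + b • (z • y + z ^ 2 • r + z ^ 3 • u) := by
    intro a b z; module
  have e' : ∀ (a b z : ℂ), (a • x + b • y) + (2 * z) • (a • p + b • r) + (3 * z ^ 2) • (a • q + b • u) =
      a • (x + (2 * z) • p + (3 * z ^ 2) • q) + b • (y + (2 * z) • r + (3 * z ^ 2) • u) := by
    intro a b z; module
  constructor
  · intro z
    rw [e, e, MA_rot _ _ _ _ _ _ hu]
    exact h.1 z
  · intro z
    rw [e, e, e', e', MB_rot _ _ _ _ _ _ _ _ hu]
    exact h.2 z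

lemma rot_of {n : ℕ} (A B : Fin n → ℂ) (a b c d : ℂ) :
    !![a, b; c, d] * Matrix.of ![A, B] = Matrix.of ![a • A + b • B, c • A + d • B] := by
  ext i j
  fin_cases i <;> simp [Matrix.mul_apply, Fin.sum_univ_two]

lemma rot_cubic {n : ℕ} (x p q y r u : Fin n → ℂ) (a b z : ℂ) :
    a • (z • x + z ^ 2 • p + z ^ 3 • q) + b • (z • y + z ^ 2 • r + z ^ 3 • u) =
    z • (a • x + b • y) + z ^ 2 • (a • p + b • r) + z ^ 3 • (a • q + b • u) := by
  module

/-- The conclusion, for a curve satisfying the two conditions. -/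
def Concl {n : ℕ} (c : ℝ) (x p q y r u : Fin n → ℂ) : Prop :=
    4 ≤ n ∧
      ∃ t ∈ Set.Ioc (0 : ℝ) 3, t ≠ 2 ∧ c = 4 * t - t ^ 2 ∧
      ∃ P : Matrix (Fin 2) (Fin 2) ℂ, P ∈ Matrix.unitaryGroup (Fin 2) ℂ ∧
      ∃ Q : Matrix (Fin n) (Fin n) ℂ, Q ∈ Matrix.unitaryGroup (Fin n) ℂ ∧
        ∀ z : ℂ,
          P * Matrix.of ![z • x + z ^ 2 • p + z ^ 3 • q,
                          z • y + z ^ 2 • r + z ^ 3 • u] * Q =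
            Matrix.of ![pad4 (F1t t z), pad4 (F2t t z)]

lemma Concl.of_rot {n : ℕ} {c₀ : ℝ} {x p q y r u : Fin n → ℂ} (a b c d : ℂ)
    (hu : !![a, b; c, d] ∈ Matrix.unitaryGroup (Fin 2) ℂ)
    (h : Concl c₀ (a • x + b • y) (a • p + b • r) (a • q + b • u)
      (c • x + d • y) (c • p + d • r) (c • q + d • u)) : Concl c₀ x p q y r u := by
  obtain ⟨h4, t, ht, ht2, hc, P, hP, Q, hQ, H⟩ := h
  refine ⟨h4, t, ht, ht2, hc, P * !![a, b; c, d], mul_mem hP hu, Q, hQ, fun z => ?_⟩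
  rw [Matrix.mul_assoc P, rot_of, rot_cubic, rot_cubic, H]

lemma concl_final {n : ℕ} {c : ℝ} (hc : 0 < c) (x p y e : Fin n → ℂ) (s m : ℝ) (hs : 0 < s)
    (hm : 0 ≤ m) (hee : hinner e e = 1)
    (h : Good c x p ((s : ℂ) • e) y ((m : ℂ) • e) 0) :
    Concl c x p ((s : ℂ) • e) y ((m : ℂ) • e) 0 := by
  obtain ⟨t, t0, t3, t2, hct, hst, hmt, hxx, hyy, hpp, hxy, hxp, hxe, hye, hpe, hpy⟩ :=
    core x p y e s m c hs hm hc hee h.1 h.2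
  obtain ⟨h4, Q, hQ, H⟩ := finish x p y e s m t t0 t3 hst hmt hee hxx hyy hpp hxy hxp hxe hye hpe hpy
  refine ⟨h4, t, ⟨t0, t3⟩, t2, hct, 1, one_mem _, Q, hQ, fun z => ?_⟩
  rw [Matrix.one_mul, H]

lemma exists_phase (μ : ℂ) : ∃ ω : ℂ, ω * starRingEnd ℂ ω = 1 ∧ ω * μ = (‖μ‖ : ℂ) := by
  by_cases h0 : μ = 0
  · exact ⟨1, by simp, by simp [h0]⟩
  · have hn : (‖μ‖ : ℂ) ≠ 0 := by simpa using h0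
    have hk : starRingEnd ℂ μ * μ = (‖μ‖ : ℂ) ^ 2 := by
      rw [mul_comm, Complex.mul_conj, Complex.normSq_eq_norm_sq]; push_cast; rfl
    refine ⟨starRingEnd ℂ μ / ‖μ‖, ?_, ?_⟩
    · simp only [map_div₀, Complex.conj_conj, Complex.conj_ofReal]
      field_simp
      exact hk
    · field_simp
      exact hk

lemma exists_unit {n : ℕ} (q : Fin n → ℂ) (hq : q ≠ 0) :
    ∃ (s : ℝ) (e : Fin n → ℂ), 0 < s ∧ hinner e e = 1 ∧ q = (s : ℂ) • e := by
  obtain ⟨S, hS, eS⟩ := hinner_self_real q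
  have hS0 : 0 < S := by
    rcases hS.lt_or_eq with h | h
    · exact h
    · exact absurd (hinner_self_eq_zero (by rw [eS, ← h]; simp)) hq
  obtain ⟨s, hs, hs2⟩ : ∃ s : ℝ, 0 < s ∧ s ^ 2 = S := ⟨√S, Real.sqrt_pos.2 hS0, Real.sq_sqrt hS⟩
  have hsC : (s : ℂ) ≠ 0 := by exact_mod_cast hs.ne'
  refine ⟨s, ((s⁻¹ : ℝ) : ℂ) • q, hs, ?_, ?_⟩
  · rw [hinner_smul_right, hinner_smul_left, eS, Complex.conj_ofReal, ← hs2]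
    push_cast
    field_simp
  · rw [smul_smul]; push_cast; rw [mul_inv_cancel₀ hsC, one_smul]

lemma concl_u0_aux {n : ℕ} {c : ℝ} (hc : 0 < c) (x p y e : Fin n → ℂ) (s : ℝ) (μ : ℂ)
    (hs : 0 < s) (hee : hinner e e = 1)
    (h : Good c x p ((s : ℂ) • e) y (μ • e) 0) : Concl c x p ((s : ℂ) • e) y (μ • e) 0 := by
  obtain ⟨ω, hω, hωμ⟩ := exists_phase μ
  have hu : !![1, 0; 0, ω] ∈ Matrix.unitaryGroup (Fin 2) ℂ := by
    rw [Matrix.mem_unitaryGroup_iff]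
    ext i j
    fin_cases i <;> fin_cases j <;> simp [Matrix.mul_apply, Fin.sum_univ_two, Matrix.star_apply, hω]
  have hrot := h.rot 1 0 0 ω hu
  apply Concl.of_rot 1 0 0 ω hu
  have e1 : ∀ v w : Fin n → ℂ, (1 : ℂ) • v + (0 : ℂ) • w = v := by intro v w; simp
  have e2 : ∀ v w : Fin n → ℂ, (0 : ℂ) • v + ω • w = ω • w := by intro v w; simp
  have e3 : ω • μ • e = ((‖μ‖ : ℝ) : ℂ) • e := by rw [smul_smul, hωμ]
  have e4 : ω • (0 : Fin n → ℂ) = 0 := smul_zero _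
  rw [e1, e1, e1, e2, e2, e2, e3, e4] at hrot ⊢
  exact concl_final hc _ _ _ _ _ _ hs (norm_nonneg _) hee hrot

lemma concl_u0 {n : ℕ} {c : ℝ} (hc : 0 < c) (x p q y r : Fin n → ℂ) (hq : q ≠ 0)
    (h : Good c x p q y r 0) : Concl c x p q y r 0 := by
  have a55 := (extractA _ _ _ _ _ _ h.1).2.2.2.2.1
  simp only [hinner_zero_left, hinner_zero_right, mul_zero, zero_mul, add_zero, zero_add, sub_zero] at a55
  have hl := hinner_dep hq a55
  generalize hinner r q / hinner q q = l at hl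
  obtain ⟨s, e, hs, hee, hqe⟩ := exists_unit q hq
  rw [hqe, smul_smul] at hl
  rw [hqe, hl] at h ⊢
  exact concl_u0_aux hc x p y e s _ hs hee h

lemma concl_all {n : ℕ} {c : ℝ} (hc : 0 < c) (x p q y r u : Fin n → ℂ) (h3 : ¬(q = 0 ∧ u = 0))
    (h : Good c x p q y r u) : Concl c x p q y r u := by
  obtain ⟨-, -, -, -, -, a66, -⟩ := extractA _ _ _ _ _ _ h.1
  by_cases hq : q = 0
  · have hu0 : u ≠ 0 := fun hu => h3 ⟨hq, hu⟩
    have hu : !![0, 1; 1, 0] ∈ Matrix.unitaryGroup (Fin 2) ℂ := by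
      rw [Matrix.mem_unitaryGroup_iff]
      ext i j
      fin_cases i <;> fin_cases j <;> simp [Matrix.mul_apply, Fin.sum_univ_two, Matrix.star_apply]
    have hrot := h.rot _ _ _ _ hu
    apply Concl.of_rot _ _ _ _ hu
    subst hq
    simp only [one_smul, zero_smul, add_zero, zero_add] at hrot ⊢
    exact concl_u0 hc _ _ _ _ _ hu0 hrot
  · have hdep := hinner_dep hq a66
    generalize hinner u q / hinner q q = l at hdep
    obtain ⟨k, hk0, hk⟩ : ∃ k : ℝ, 0 < k ∧ k ^ 2 * (1 + Complex.normSq l) = 1 := by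
      have h1 : 0 < 1 + Complex.normSq l := by linarith [Complex.normSq_nonneg l]
      refine ⟨(√(1 + Complex.normSq l))⁻¹, by positivity, ?_⟩
      rw [inv_pow, Real.sq_sqrt h1.le]
      field_simp
    have hkC : (k : ℂ) ^ 2 * (1 + l * starRingEnd ℂ l) = 1 := by
      rw [Complex.mul_conj]; exact_mod_cast hk
    have hu : !![(k : ℂ), k * starRingEnd ℂ l; -k * l, k] ∈ Matrix.unitaryGroup (Fin 2) ℂ := by
      rw [Matrix.mem_unitaryGroup_iff]
      ext i j
      fin_cases i <;> fin_cases j <;> simp [Matrix.mul_apply, Fin.sum_univ_two, Matrix.star_apply]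
      · linear_combination hkC
      · ring
      · ring
      · linear_combination hkC
    have hrot := h.rot _ _ _ _ hu
    apply Concl.of_rot _ _ _ _ hu
    have e0 : (-k * l) • q + (k : ℂ) • u = 0 := by rw [hdep]; module
    rw [e0] at hrot ⊢
    refine concl_u0 hc _ _ _ _ _ ?_ hrot
    have : (k : ℂ) • q + ((k : ℂ) * starRingEnd ℂ l) • u = (k * (1 + l * starRingEnd ℂ l)) • q := by
      rw [hdep]; module
    rw [this]
    refine smul_ne_zero ?_ hq
    intro h0
    have : (k : ℂ) * (k * (1 + l * starRingEnd ℂ l)) = 1 := by linear_combination hkC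
    rw [h0] at this
    simp at this

end helpers

theorem stmt6 (n : ℕ) (hn : 1 ≤ n) (a11 a21 a12 a22 a13 a23 : Fin n → ℂ)
    (h3 : ¬(a13 = 0 ∧ a23 = 0)) (c : ℝ) (hc : 0 < c)
    (hA : CondA 4 (fun z => z • a11 + z ^ 2 • a12 + z ^ 3 • a13)
      (fun z => z • a21 + z ^ 2 • a22 + z ^ 3 • a23))
    (hB : CondB 4 c (fun z => z • a11 + z ^ 2 • a12 + z ^ 3 • a13)
      (fun z => z • a21 + z ^ 2 • a22 + z ^ 3 • a23)) :
    4 ≤ n ∧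
      ∃ t ∈ Set.Ioc (0 : ℝ) 3, t ≠ 2 ∧ c = 4 * t - t ^ 2 ∧
      ∃ P : Matrix (Fin 2) (Fin 2) ℂ, P ∈ Matrix.unitaryGroup (Fin 2) ℂ ∧
      ∃ Q : Matrix (Fin n) (Fin n) ℂ, Q ∈ Matrix.unitaryGroup (Fin n) ℂ ∧
        ∀ z : ℂ,
          P * Matrix.of ![z • a11 + z ^ 2 • a12 + z ^ 3 • a13,
                          z • a21 + z ^ 2 • a22 + z ^ 3 • a23] * Q =
            Matrix.of ![pad4 (F1t t z), pad4 (F2t t z)] := by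
  exact concl_all hc a11 a12 a13 a21 a22 a23 h3 ⟨condA_MA _ _ _ _ _ _ hA, condB_MB _ _ _ _ _ _ hB⟩
end

section
/- Let n ≥ 1 and a_i^{(α)} ∈ ℂⁿ for i ∈ {1,2}, α ∈ {1,2,3}, and set F_i(z) = Σ_{α=1}^3 a_i^{(α)} z^α. Assume condition (A)₄ holds and condition (B)_{4,c} holds for some constant c > 0, and suppose a₁⁽³⁾ = λ·e₁ for some real λ > 0 (e₁ the first standard basis vector of ℂⁿ) and a₂⁽³⁾ = 0. Then the first coordinate of a₂⁽¹⁾ is zero. -/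
open scoped BigOperators
open Complex

section helpers
variable {n : ℕ}

lemma hi_add_left (x y u : Fin n → ℂ) : hinner (x + y) u = hinner x u + hinner y u := by
  simp [hinner, add_mul, Finset.sum_add_distrib]
lemma hi_add_right (x y u : Fin n → ℂ) : hinner u (x + y) = hinner u x + hinner u y := by
  simp [hinner, mul_add, Finset.sum_add_distrib]
lemma hi_sub_left (x y u : Fin n → ℂ) : hinner (x - y) u = hinner x u - hinner y u := by
  simp [hinner, sub_mul, Finset.sum_sub_distrib]
lemma hi_sub_right (x y u : Fin n → ℂ) : hinner u (x - y) = hinner u x - hinner u y := by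
  simp [hinner, mul_sub, Finset.sum_sub_distrib]
lemma hi_smul_left (a : ℂ) (x u : Fin n → ℂ) : hinner (a • x) u = a * hinner x u := by
  simp [hinner, Finset.mul_sum, mul_assoc]
lemma hi_smul_right (a : ℂ) (x u : Fin n → ℂ) :
    hinner u (a • x) = (starRingEnd ℂ) a * hinner u x := by
  simp only [hinner, Finset.mul_sum, Pi.smul_apply, smul_eq_mul, map_mul]
  exact Finset.sum_congr rfl fun i _ => by ring
lemma hi_conj (x u : Fin n → ℂ) : (starRingEnd ℂ) (hinner x u) = hinner u x := by
  simp [hinner, mul_comm]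
lemma hi_zero_left (u : Fin n → ℂ) : hinner 0 u = 0 := by simp [hinner]
lemma hi_zero_right (u : Fin n → ℂ) : hinner u 0 = 0 := by simp [hinner]

lemma hi_self_eq_zero (x : Fin n → ℂ) (h : hinner x x = 0) : x = 0 := by
  have h1 : ∑ i, Complex.normSq (x i) = 0 := by
    have : ((∑ i, Complex.normSq (x i) : ℝ) : ℂ) = 0 := by
      rw [← h]; simp [hinner, Complex.mul_conj]
    exact_mod_cast this
  rw [Finset.sum_eq_zero_iff_of_nonneg (fun i _ => Complex.normSq_nonneg _)] at h1
  funext i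
  simpa using h1 i (Finset.mem_univ i)

/-- polarized inner product of two quadratic vector polynomials -/
noncomputable def KK (x0 x1 x2 y0 y1 y2 : Fin n → ℂ) (z w : ℂ) : ℂ :=
  (hinner x0 y0 + w * hinner x0 y1 + w ^ 2 * hinner x0 y2)
  + z * (hinner x1 y0 + w * hinner x1 y1 + w ^ 2 * hinner x1 y2)
  + z ^ 2 * (hinner x2 y0 + w * hinner x2 y1 + w ^ 2 * hinner x2 y2)

lemma KK_eq (x0 x1 x2 y0 y1 y2 : Fin n → ℂ) (z : ℂ) :
    hinner (x0 + z • x1 + z ^ 2 • x2) (y0 + z • y1 + z ^ 2 • y2)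
      = KK x0 x1 x2 y0 y1 y2 z ((starRingEnd ℂ) z) := by
  simp only [hi_add_left, hi_add_right, hi_smul_left, hi_smul_right, KK, map_pow]
  ring

lemma entire_zero (f : ℂ → ℂ) (hf : Differentiable ℂ f) (h : ∀ x : ℝ, f x = 0) (z : ℂ) :
    f z = 0 := by
  have ha : AnalyticOnNhd ℂ f Set.univ := fun z _ => hf.analyticAt z
  have hfr : ∃ᶠ z in nhdsWithin (0:ℂ) {0}ᶜ, f z = (0 : ℂ → ℂ) z := by
    have ht : Filter.Tendsto (fun k : ℕ => (((1 / ((k : ℝ) + 1) : ℝ)) : ℂ)) Filter.atTop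
        (nhdsWithin (0:ℂ) {0}ᶜ) := by
      rw [tendsto_nhdsWithin_iff]
      constructor
      · have := (Complex.continuous_ofReal.tendsto 0).comp
          (tendsto_one_div_add_atTop_nhds_zero_nat (𝕜 := ℝ))
        simpa [Function.comp_def] using this
      · refine Filter.Eventually.of_forall fun k => ?_
        simp only [Set.mem_compl_iff, Set.mem_singleton_iff, Complex.ofReal_eq_zero]
        positivity
    exact ht.frequently (Filter.Frequently.of_forall fun k => h _)
  exact ha.eqOn_of_preconnected_of_frequently_eq (fun z _ => analyticAt_const)
    isPreconnected_univ (Set.mem_univ 0) hfr (Set.mem_univ z)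

lemma polarize (f : ℂ → ℂ → ℂ)
    (hf : Differentiable ℂ (fun q : ℂ × ℂ => f q.1 q.2))
    (h : ∀ z, f z ((starRingEnd ℂ) z) = 0) (z w : ℂ) : f z w = 0 := by
  have key : ∀ x y : ℂ, f (x + I * y) (x - I * y) = 0 := by
    intro x y
    refine entire_zero (fun y => f (x + I * y) (x - I * y)) ?_ (fun y => ?_) y
    · exact hf.comp (f := fun y : ℂ => (x + I * y, x - I * y)) (by fun_prop)
    refine entire_zero (fun x => f (x + I * y) (x - I * y)) ?_ (fun x => ?_) x
    · exact hf.comp (f := fun x : ℂ => (x + I * y, x - I * y)) (by fun_prop)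
    have := h (x + I * y)
    simpa [sub_eq_add_neg] using this
  have := key ((z + w) / 2) (-I * (z - w) / 2)
  convert this using 2 <;> ring_nf <;> rw [I_sq] <;> ring

lemma low (α β : ℂ) (S : ℂ → ℂ) (hS : Continuous S)
    (h : ∀ z, α + β * z + z ^ 2 * S z = 0) : α = 0 ∧ β = 0 := by
  have h0 : α = 0 := by simpa using h 0
  refine ⟨h0, ?_⟩
  have h1 : ∀ z : ℂ, z ≠ 0 → β + z * S z = 0 := by
    intro z hz
    have := h z
    rw [h0] at this
    have h2 : z * (β + z * S z) = 0 := by linear_combination this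
    exact (mul_eq_zero.mp h2).resolve_left hz
  have hc : Continuous fun z : ℂ => β + z * S z := by fun_prop
  have := Continuous.ext_on (s := {0}ᶜ) (dense_compl_singleton (0:ℂ)) hc
    (continuous_const (y := (0:ℂ))) (fun z hz => h1 z hz)
  simpa using congrFun this 0

lemma low5 (c0 c1 c2 c3 c4 c5 : ℂ)
    (h : ∀ z : ℂ, c0 + c1 * z + c2 * z ^ 2 + c3 * z ^ 3 + c4 * z ^ 4 + c5 * z ^ 5 = 0) :
    c0 = 0 ∧ c1 = 0 ∧ c2 = 0 ∧ c3 = 0 ∧ c4 = 0 ∧ c5 = 0 := by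
  obtain ⟨h0, h1⟩ := low c0 c1 (fun z => c2 + c3 * z + c4 * z ^ 2 + c5 * z ^ 3) (by fun_prop)
    (fun z => by linear_combination h z)
  subst h0 h1
  have e1 := h 1
  have e2 := h (-1)
  have e3 := h 2
  have e4 := h (-2)
  refine ⟨rfl, rfl, ?_, ?_, ?_, ?_⟩
  · linear_combination (2/3) * e1 + (2/3) * e2 - (1/24) * e3 - (1/24) * e4
  · linear_combination (2/3) * e1 - (2/3) * e2 - (1/48) * e3 + (1/48) * e4
  · linear_combination (-1/6) * e1 - (1/6) * e2 + (1/24) * e3 + (1/24) * e4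
  · linear_combination (-1/6) * e1 + (1/6) * e2 + (1/48) * e3 - (1/48) * e4

lemma hi_cons (a b c d : ℂ) (x y : Fin n → ℂ) :
    hinner (Fin.cons a (Fin.cons b x) : Fin (n+2) → ℂ) (Fin.cons c (Fin.cons d y))
      = a * (starRingEnd ℂ) c + b * (starRingEnd ℂ) d + hinner x y := by
  simp [hinner, Fin.sum_univ_succ, add_assoc]

/-- block determinant remainder -/
def RR (t K11 K12 X11 X12 K21 K22 X21 X22 Y11 Y12 D11 D12 Y21 Y22 D21 D22 : ℂ) : ℂ :=
  0 + t * K11 * K22 * D11 * D22 + K11 * D11 * D22 + K22 * D11 * D22 - t * K11 * K22 * D12 * D21 - K11 * D12 * D21 - K22 * D12 * D21 - t * K11 * X21 * Y12 * D22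
   - X21 * Y12 * D22 + t * K11 * X21 * D12 * Y22
   + X21 * D12 * Y22 + t * K11 * X22 * Y12 * D21
   + X22 * Y12 * D21 - t * K11 * X22 * D11 * Y22
   - X22 * D11 * Y22 - t * K12 * K21 * D11 * D22 + t * K12 * K21 * D12 * D21 + t * K12 * X21 * Y11 * D22 - t * K12 * X21 * D12 * Y21 - t * K12 * X22 * Y11 * D21 + t * K12 * X22 * D11 * Y21 + t * X11 * K21 * Y12 * D22 - t * X11 * K21 * D12 * Y22 - t * X11 * K22 * Y11 * D22
   - X11 * Y11 * D22 + t * X11 * K22 * D12 * Y21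
   + X11 * D12 * Y21 + t * X11 * X22 * Y11 * Y22 - t * X11 * X22 * Y12 * Y21 - t * X12 * K21 * Y12 * D21 + t * X12 * K21 * D11 * Y22 + t * X12 * K22 * Y11 * D21
   + X12 * Y11 * D21 - t * X12 * K22 * D11 * Y21
   - X12 * D11 * Y21 - t * X12 * X21 * Y11 * Y22 + t * X12 * X21 * Y12 * Y21

lemma gram_row (U1 U2 G1 G2 : Fin n → ℂ) (z : ℂ) :
    gram ![Fin.cons 1 (Fin.cons 0 (z • G1 - z ^ 2 • U1)), Fin.cons 0 (Fin.cons 1 (z • G2 - z ^ 2 • U2)),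
      Fin.cons 0 (Fin.cons 0 G1), Fin.cons 0 (Fin.cons 0 G2)] =
    (hinner G1 G1 * hinner G2 G2 - hinner G1 G2 * hinner G2 G1) +
    (z ^ 2 * (starRingEnd ℂ) z ^ 2) * RR (z ^ 2 * (starRingEnd ℂ) z ^ 2) (hinner U1 U1) (hinner U1 U2) (-hinner U1 G1) (-hinner U1 G2)
      (hinner U2 U1) (hinner U2 U2) (-hinner U2 G1) (-hinner U2 G2)
      (-hinner G1 U1) (-hinner G1 U2) (hinner G1 G1) (hinner G1 G2)
      (-hinner G2 U1) (-hinner G2 U2) (hinner G2 G1) (hinner G2 G2) := by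
  unfold gram
  simp only [Matrix.det_succ_row_zero, Fin.sum_univ_succ]
  simp [Fin.succAbove, hi_cons, Fin.sum_univ_succ]
  simp only [hi_sub_left, hi_sub_right, hi_smul_left, hi_smul_right, map_pow, RR]
  ring
end helpers

section coefs
variable {n : ℕ}

/-- polarized inner product of two decomposable bivectors -/
noncomputable def WW (x y u v : Fin n → ℂ) : ℂ :=
  hinner x u * hinner y v - hinner x v * hinner y u

lemma polA (a1 a2 a3 b1 b2 : Fin n → ℂ)
    (hA : CondA 4 (fun z => z • a1 + z ^ 2 • a2 + z ^ 3 • a3)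
      (fun z => z • b1 + z ^ 2 • b2 + z ^ 3 • (0 : Fin n → ℂ))) (z w : ℂ) :
    1 + z * w * KK a1 a2 a3 a1 a2 a3 z w + z * w * KK b1 b2 0 b1 b2 0 z w
      + z ^ 2 * w ^ 2 * (KK a1 a2 a3 a1 a2 a3 z w * KK b1 b2 0 b1 b2 0 z w
        - KK a1 a2 a3 b1 b2 0 z w * KK b1 b2 0 a1 a2 a3 z w) - (1 + z * w) ^ 4 = 0 := by
  refine polarize (fun z w => 1 + z * w * KK a1 a2 a3 a1 a2 a3 z w + z * w * KK b1 b2 0 b1 b2 0 z w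
      + z ^ 2 * w ^ 2 * (KK a1 a2 a3 a1 a2 a3 z w * KK b1 b2 0 b1 b2 0 z w
        - KK a1 a2 a3 b1 b2 0 z w * KK b1 b2 0 a1 a2 a3 z w) - (1 + z * w) ^ 4) ?_ ?_ z w
  · simp only [KK]; fun_prop
  intro z
  have h := hA z
  have e : ∀ x y u : Fin n → ℂ, z • x + z ^ 2 • y + z ^ 3 • u = z • (x + z • y + z ^ 2 • u) := by
    intro x y u
    simp only [smul_add, smul_smul]; ring_nf
  simp only [e, hi_conj] at h
  simp only [hi_smul_left, hi_smul_right, KK_eq, ← Complex.mul_conj] at h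
  linear_combination h

lemma polB (a1 a2 a3 b1 b2 : Fin n → ℂ) (c : ℝ)
    (hB : CondB 4 c (fun z => z • a1 + z ^ 2 • a2 + z ^ 3 • a3)
      (fun z => z • b1 + z ^ 2 • b2 + z ^ 3 • (0 : Fin n → ℂ))) (z w : ℂ) :
    (KK a1 ((2:ℂ) • a2) ((3:ℂ) • a3) a1 ((2:ℂ) • a2) ((3:ℂ) • a3) z w * KK b1 ((2:ℂ) • b2) 0 b1 ((2:ℂ) • b2) 0 z w
      - KK a1 ((2:ℂ) • a2) ((3:ℂ) • a3) b1 ((2:ℂ) • b2) 0 z w * KK b1 ((2:ℂ) • b2) 0 a1 ((2:ℂ) • a2) ((3:ℂ) • a3) z w)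
    + z ^ 2 * w ^ 2 * RR (z ^ 2 * w ^ 2)
      (KK a2 ((2:ℂ) • a3) 0 a2 ((2:ℂ) • a3) 0 z w) (KK a2 ((2:ℂ) • a3) 0 b2 0 0 z w)
      (-KK a2 ((2:ℂ) • a3) 0 a1 ((2:ℂ) • a2) ((3:ℂ) • a3) z w) (-KK a2 ((2:ℂ) • a3) 0 b1 ((2:ℂ) • b2) 0 z w)
      (KK b2 0 0 a2 ((2:ℂ) • a3) 0 z w) (KK b2 0 0 b2 0 0 z w)
      (-KK b2 0 0 a1 ((2:ℂ) • a2) ((3:ℂ) • a3) z w) (-KK b2 0 0 b1 ((2:ℂ) • b2) 0 z w)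
      (-KK a1 ((2:ℂ) • a2) ((3:ℂ) • a3) a2 ((2:ℂ) • a3) 0 z w) (-KK a1 ((2:ℂ) • a2) ((3:ℂ) • a3) b2 0 0 z w)
      (KK a1 ((2:ℂ) • a2) ((3:ℂ) • a3) a1 ((2:ℂ) • a2) ((3:ℂ) • a3) z w) (KK a1 ((2:ℂ) • a2) ((3:ℂ) • a3) b1 ((2:ℂ) • b2) 0 z w)
      (-KK b1 ((2:ℂ) • b2) 0 a2 ((2:ℂ) • a3) 0 z w) (-KK b1 ((2:ℂ) • b2) 0 b2 0 0 z w)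
      (KK b1 ((2:ℂ) • b2) 0 a1 ((2:ℂ) • a2) ((3:ℂ) • a3) z w) (KK b1 ((2:ℂ) • b2) 0 b1 ((2:ℂ) • b2) 0 z w)
    - c * (1 + z * w) ^ 4 = 0 := by
  revert z w
  apply polarize
  · simp only [KK, RR]; fun_prop
  intro z
  have h := hB z
  have d1 : deriv (vOne (fun z : ℂ => z • a1 + z ^ 2 • a2 + z ^ 3 • a3)) z
      = Fin.cons 0 (Fin.cons 0 (a1 + z • (2:ℂ) • a2 + z ^ 2 • (3:ℂ) • a3)) := by
    apply HasDerivAt.deriv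
    rw [hasDerivAt_pi]
    intro i
    refine Fin.cases ?_ (fun i => Fin.cases ?_ (fun i => ?_) i) i
    · simpa [vOne] using hasDerivAt_const z (1:ℂ)
    · simpa [vOne] using hasDerivAt_const z (0:ℂ)
    · simp only [vOne, Fin.cons_succ, Pi.add_apply, Pi.smul_apply, smul_eq_mul]
      have := (((hasDerivAt_id z).mul_const (a1 i)).add ((hasDerivAt_pow 2 z).mul_const (a2 i))).add
        ((hasDerivAt_pow 3 z).mul_const (a3 i))
      refine HasDerivAt.congr_deriv this ?_
      simp; ring
  have d2 : deriv (vTwo (fun z : ℂ => z • b1 + z ^ 2 • b2 + z ^ 3 • (0 : Fin n → ℂ))) z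
      = Fin.cons 0 (Fin.cons 0 (b1 + z • (2:ℂ) • b2 + z ^ 2 • 0)) := by
    apply HasDerivAt.deriv
    rw [hasDerivAt_pi]
    intro i
    refine Fin.cases ?_ (fun i => Fin.cases ?_ (fun i => ?_) i) i
    · simpa [vTwo] using hasDerivAt_const z (0:ℂ)
    · simpa [vTwo] using hasDerivAt_const z (1:ℂ)
    · simp only [vTwo, Fin.cons_succ, Pi.add_apply, Pi.smul_apply, smul_eq_mul]
      have := (((hasDerivAt_id z).mul_const (b1 i)).add ((hasDerivAt_pow 2 z).mul_const (b2 i))).add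
        ((hasDerivAt_pow 3 z).mul_const (0:ℂ))
      refine HasDerivAt.congr_deriv this ?_
      simp; ring
  have e1 : z • a1 + z ^ 2 • a2 + z ^ 3 • a3 = z • (a1 + z • (2:ℂ) • a2 + z ^ 2 • (3:ℂ) • a3)
      - z ^ 2 • (a2 + z • (2:ℂ) • a3 + z ^ 2 • 0) := by
    funext i; simp; ring
  have e2 : z • b1 + z ^ 2 • b2 + z ^ 3 • (0 : Fin n → ℂ) = z • (b1 + z • (2:ℂ) • b2 + z ^ 2 • 0)
      - z ^ 2 • (b2 + z • 0 + z ^ 2 • 0) := by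
    funext i; simp; ring
  rw [d1, d2] at h
  simp only [vOne, vTwo] at h
  rw [e1, e2, gram_row, ← Complex.mul_conj] at h
  simp only [KK_eq] at h
  linear_combination h

lemma coefA (a1 a2 a3 b1 b2 : Fin n → ℂ)
    (hA : CondA 4 (fun z => z • a1 + z ^ 2 • a2 + z ^ 3 • a3)
      (fun z => z • b1 + z ^ 2 • b2 + z ^ 3 • (0 : Fin n → ℂ))) :
    hinner a1 a1 + hinner b1 b1 = 4 ∧ hinner a1 a2 + hinner b1 b2 = 0 ∧ hinner a1 a3 = 0 ∧
    hinner a2 a2 + hinner b2 b2 + WW a1 b1 a1 b1 = 6 ∧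
    hinner a2 a3 + WW a1 b1 a1 b2 + WW a1 b1 a2 b1 = 0 ∧
    WW a1 b1 a2 b2 + WW a1 b1 a3 b1 = 0 ∧
    hinner a3 a3 + WW a1 b2 a1 b2 + WW a1 b2 a2 b1 + WW a2 b1 a1 b2 + WW a2 b1 a2 b1 = 4 ∧
    WW a1 b2 a2 b2 + WW a1 b2 a3 b1 + WW a2 b1 a2 b2 + WW a2 b1 a3 b1 = 0 ∧
    WW a2 b2 a2 b2 + WW a2 b2 a3 b1 + WW a3 b1 a2 b2 + WW a3 b1 a3 b1 = 1 ∧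
    WW a3 b2 a3 b2 = 0 := by
  have hP := polA a1 a2 a3 b1 b2 hA
  let r : (Fin n → ℂ) → ℂ → ℂ := fun x w => hinner x a1 + w * hinner x a2 + w ^ 2 * hinner x a3
  let s : (Fin n → ℂ) → ℂ → ℂ := fun x w => hinner x b1 + w * hinner x b2
  have hc := fun w => low5 0 (w * r a1 w + w * s b1 w - 4 * w)
    (w * r a2 w + w * s b2 w + w ^ 2 * (r a1 w * s b1 w - s a1 w * r b1 w) - 6 * w ^ 2)
    (w * r a3 w + w ^ 2 * (r a1 w * s b2 w + r a2 w * s b1 w - s a1 w * r b2 w - s a2 w * r b1 w)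
      - 4 * w ^ 3)
    (w ^ 2 * (r a2 w * s b2 w + r a3 w * s b1 w - s a2 w * r b2 w - s a3 w * r b1 w) - w ^ 4)
    (w ^ 2 * (r a3 w * s b2 w - s a3 w * r b2 w))
    (fun z => by
      have := hP z w
      simp only [KK, hi_zero_left, hi_zero_right] at this
      simp only [r, s]
      linear_combination this)
  have h1 := fun w => (hc w).2.1
  have h2 := fun w => (hc w).2.2.1
  have h3 := fun w => (hc w).2.2.2.1
  have h4 := fun w => (hc w).2.2.2.2.1
  have h5 := fun w => (hc w).2.2.2.2.2
  clear hc hP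
  simp only [r, s] at h1 h2 h3 h4 h5
  unfold WW
  refine ⟨?_, ?_, ?_, ?_, ?_, ?_, ?_, ?_, ?_, ?_⟩
  · linear_combination (-1/3) * h1 (0) + (1) * h1 (1) + (-1/2) * h1 (-1) + (-1/4) * h1 (2) + (1/20) * h1 (-2) + (1/30) * h1 (3)
  · linear_combination (-5/4) * h1 (0) + (2/3) * h1 (1) + (2/3) * h1 (-1) + (-1/24) * h1 (2) + (-1/24) * h1 (-2)
  · linear_combination (5/12) * h1 (0) + (-7/12) * h1 (1) + (-1/24) * h1 (-1) + (7/24) * h1 (2) + (-1/24) * h1 (-2) + (-1/24) * h1 (3)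
  · linear_combination (-5/4) * h2 (0) + (2/3) * h2 (1) + (2/3) * h2 (-1) + (-1/24) * h2 (2) + (-1/24) * h2 (-2)
  · linear_combination (5/12) * h2 (0) + (-7/12) * h2 (1) + (-1/24) * h2 (-1) + (7/24) * h2 (2) + (-1/24) * h2 (-2) + (-1/24) * h2 (3)
  · linear_combination (1/4) * h2 (0) + (-1/6) * h2 (1) + (-1/6) * h2 (-1) + (1/24) * h2 (2) + (1/24) * h2 (-2)
  · linear_combination (5/12) * h3 (0) + (-7/12) * h3 (1) + (-1/24) * h3 (-1) + (7/24) * h3 (2) + (-1/24) * h3 (-2) + (-1/24) * h3 (3)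
  · linear_combination (1/4) * h3 (0) + (-1/6) * h3 (1) + (-1/6) * h3 (-1) + (1/24) * h3 (2) + (1/24) * h3 (-2)
  · linear_combination (1/4) * h4 (0) + (-1/6) * h4 (1) + (-1/6) * h4 (-1) + (1/24) * h4 (2) + (1/24) * h4 (-2)
  · linear_combination (-1/12) * h5 (0) + (1/12) * h5 (1) + (1/24) * h5 (-1) + (-1/24) * h5 (2) + (-1/120) * h5 (-2) + (1/120) * h5 (3)

lemma coefB (a1 a2 a3 b1 b2 : Fin n → ℂ) (c : ℝ)
    (hB : CondB 4 c (fun z => z • a1 + z ^ 2 • a2 + z ^ 3 • a3)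
      (fun z => z • b1 + z ^ 2 • b2 + z ^ 3 • (0 : Fin n → ℂ))) :
    WW a1 b1 a1 b2 + WW a1 b1 a2 b1 = 0 ∧
    4 * WW a1 b1 a2 b2 + 3 * WW a1 b1 a3 b1 = 0 ∧
    4 * WW a1 b2 a2 b2 + 3 * WW a1 b2 a3 b1 + 4 * WW a2 b1 a2 b2 + 3 * WW a2 b1 a3 b1 = 0 := by
  have hP := polB a1 a2 a3 b1 b2 c hB
  let r : (Fin n → ℂ) → ℂ → ℂ :=
    fun x w => hinner x a1 + 2 * w * hinner x a2 + 3 * w ^ 2 * hinner x a3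
  let s : (Fin n → ℂ) → ℂ → ℂ := fun x w => hinner x b1 + 2 * w * hinner x b2
  have hc : ∀ w, (r a1 w * s b1 w - s a1 w * r b1 w - c = 0) ∧
    (2 * (r a1 w * s b2 w + r a2 w * s b1 w - s a1 w * r b2 w - s a2 w * r b1 w) - 4 * c * w = 0) := by
    intro w
    have hw := fun z => hP z w
    generalize hR : (fun z => RR (z ^ 2 * w ^ 2)
      (KK a2 ((2:ℂ) • a3) 0 a2 ((2:ℂ) • a3) 0 z w) (KK a2 ((2:ℂ) • a3) 0 b2 0 0 z w)
      (-KK a2 ((2:ℂ) • a3) 0 a1 ((2:ℂ) • a2) ((3:ℂ) • a3) z w) (-KK a2 ((2:ℂ) • a3) 0 b1 ((2:ℂ) • b2) 0 z w)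
      (KK b2 0 0 a2 ((2:ℂ) • a3) 0 z w) (KK b2 0 0 b2 0 0 z w)
      (-KK b2 0 0 a1 ((2:ℂ) • a2) ((3:ℂ) • a3) z w) (-KK b2 0 0 b1 ((2:ℂ) • b2) 0 z w)
      (-KK a1 ((2:ℂ) • a2) ((3:ℂ) • a3) a2 ((2:ℂ) • a3) 0 z w) (-KK a1 ((2:ℂ) • a2) ((3:ℂ) • a3) b2 0 0 z w)
      (KK a1 ((2:ℂ) • a2) ((3:ℂ) • a3) a1 ((2:ℂ) • a2) ((3:ℂ) • a3) z w) (KK a1 ((2:ℂ) • a2) ((3:ℂ) • a3) b1 ((2:ℂ) • b2) 0 z w)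
      (-KK b1 ((2:ℂ) • b2) 0 a2 ((2:ℂ) • a3) 0 z w) (-KK b1 ((2:ℂ) • b2) 0 b2 0 0 z w)
      (KK b1 ((2:ℂ) • b2) 0 a1 ((2:ℂ) • a2) ((3:ℂ) • a3) z w) (KK b1 ((2:ℂ) • b2) 0 b1 ((2:ℂ) • b2) 0 z w)) = R
    have hRc : Continuous R := by
      rw [← hR]; simp only [KK, RR]; fun_prop
    have hR' := fun z => congrFun hR z
    simp only [hR'] at hw
    clear hR hR' hP
    refine low _ _ (fun z => w ^ 2 * R z
      - c * (6 * w ^ 2 + 4 * w ^ 3 * z + w ^ 4 * z ^ 2)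
      + (3 * r a3 w * s b1 w + 4 * r a2 w * s b2 w - 3 * s a3 w * r b1 w - 4 * s a2 w * r b2 w)
      + z * (6 * r a3 w * s b2 w - 6 * s a3 w * r b2 w)) (by fun_prop) (fun z => ?_)
    have := hw z
    simp only [KK, hi_zero_left, hi_zero_right, hi_smul_left, hi_smul_right, map_ofNat] at this
    simp only [r, s]
    linear_combination this
  have h0 := fun w => (hc w).1
  have h1 := fun w => (hc w).2
  clear hc hP
  simp only [r, s] at h0 h1
  unfold WW
  refine ⟨?_, ?_, ?_⟩
  · linear_combination (1/2) * ((-1/3) * h0 (0) + (1) * h0 (1) + (-1/2) * h0 (-1) + (-1/4) * h0 (2) + (1/20) * h0 (-2) + (1/30) * h0 (3))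
  · linear_combination (1) * ((-5/4) * h0 (0) + (2/3) * h0 (1) + (2/3) * h0 (-1) + (-1/24) * h0 (2) + (-1/24) * h0 (-2))
  · linear_combination (1/2) * ((-5/4) * h1 (0) + (2/3) * h1 (1) + (2/3) * h1 (-1) + (-1/24) * h1 (2) + (-1/24) * h1 (-2))

lemma final (a1 a2 a3 b1 b2 : Fin n → ℂ) (c : ℝ) (hc : 0 < c) (h33 : hinner a3 a3 ≠ 0)
    (hA : CondA 4 (fun z => z • a1 + z ^ 2 • a2 + z ^ 3 • a3)
      (fun z => z • b1 + z ^ 2 • b2 + z ^ 3 • (0 : Fin n → ℂ)))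
    (hB : CondB 4 c (fun z => z • a1 + z ^ 2 • a2 + z ^ 3 • a3)
      (fun z => z • b1 + z ^ 2 • b2 + z ^ 3 • (0 : Fin n → ℂ))) :
    hinner b1 a3 = 0 := by
  by_contra hβ
  obtain ⟨A11, A12, A13, A22, A23, A24, A33, A34, A44, A55⟩ := coefA a1 a2 a3 b1 b2 hA
  obtain ⟨B01, B02, B12⟩ := coefB a1 a2 a3 b1 b2 c hB
  have flip : ∀ x y : Fin n → ℂ, hinner x y = 0 → hinner y x = 0 := by
    intro x y h
    rw [← hi_conj, h, map_zero]
  -- b2 is a multiple of a3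
  obtain ⟨ν, hν⟩ : ∃ ν : ℂ, b2 = ν • a3 := by
    refine ⟨hinner b2 a3 / hinner a3 a3, ?_⟩
    rw [← sub_eq_zero]
    apply hi_self_eq_zero
    unfold WW at A55
    simp only [hi_sub_left, hi_sub_right, hi_smul_left, hi_smul_right, map_div₀, hi_conj]
    field_simp
    linear_combination A55
  have h23 : hinner a2 a3 = 0 := by linear_combination A23 - B01
  have hW1 : WW a1 b1 a3 b1 = 0 := by linear_combination 4 * A24 - B02
  have hW2 : WW a1 b1 a2 b2 = 0 := by linear_combination B02 - 3 * A24
  have hW3 : WW a1 b2 a3 b1 + WW a2 b1 a3 b1 = 0 := by linear_combination 4 * A34 - B12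
  have hy : hinner a1 b1 = 0 := by
    have : hinner a1 b1 * hinner b1 a3 = 0 := by
      unfold WW at hW1
      linear_combination hinner b1 b1 * A13 - hW1
    exact (mul_eq_zero.mp this).resolve_right hβ
  have ht : hinner a2 b1 = 0 := by
    have : hinner a2 b1 * hinner b1 a3 = 0 := by
      unfold WW at hW3
      linear_combination hinner b1 b1 * h23 + hinner b2 b1 * A13 - hinner b2 a3 * hy - hW3
    exact (mul_eq_zero.mp this).resolve_right hβ
  have hν0 : ν = 0 := by
    have e1 : hinner b1 b2 = (starRingEnd ℂ) ν * hinner b1 a3 := by rw [hν, hi_smul_right]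
    have : ((starRingEnd ℂ) ν * hinner b1 a3) ^ 2 = 0 := by
      unfold WW at hW2
      rw [← e1]
      linear_combination hinner b1 b2 * A12 - hW2 - hinner a1 b2 * flip _ _ ht
    have := pow_eq_zero_iff (two_ne_zero) |>.mp this
    have := (mul_eq_zero.mp this).resolve_right hβ
    simpa using this
  have hb2 : b2 = 0 := by rw [hν, hν0, zero_smul]
  clear hν
  subst hb2
  have hx : hinner a1 a2 = 0 := by simpa [hi_zero_right] using A12
  have hP := fun z => polB a1 a2 a3 b1 0 c hB z 1
  simp only [KK, RR, smul_zero, hi_zero_left, hi_zero_right, hi_smul_left, hi_smul_right, map_ofNat,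
    hx, hy, ht, h23, A13, flip _ _ hx, flip _ _ hy, flip _ _ ht, flip _ _ h23, flip _ _ A13,
    mul_zero, zero_mul, add_zero, zero_add, neg_zero, sub_zero, one_pow, mul_one, one_mul] at hP
  simp only [WW, hi_zero_left, hi_zero_right, hx, hy, ht, h23, A13, flip _ _ hx, flip _ _ hy,
    flip _ _ ht, flip _ _ h23, flip _ _ A13,
    mul_zero, zero_mul, add_zero, zero_add, neg_zero, sub_zero] at A11 A22 A33 A44
  clear hW1 hW2 hW3 A23 A24 A34 B01 B02 B12 A55 A12 hA hB
  have hcc : (c : ℂ) ≠ 0 := by exact_mod_cast hc.ne'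
  generalize hp : hinner a1 a1 = p at *
  generalize hq : hinner a2 a2 = q at *
  generalize hr : hinner b1 b1 = r at *
  generalize hL : hinner a3 a3 = L at *
  have hS : hinner a3 b1 = (starRingEnd ℂ) (hinner b1 a3) := (hi_conj _ _).symm
  generalize hb : hinner b1 a3 = β at *
  generalize hb' : hinner a3 b1 = β' at *
  have e0 : p * r - c = 0 := by linear_combination (1) * hP (0)
  have e1 : 4 * (q * r) - 4 * c = 0 := by linear_combination (-1/3) * hP (0) + (1) * hP (1) + (-1/2) * hP (-1) + (-1/4) * hP (2) + (1/20) * hP (-2) + (1/30) * hP (3)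
  have e3 : 4 * (p * (L * r - β' * β)) - 4 * c = 0 := by linear_combination (5/12) * hP (0) + (-7/12) * hP (1) + (-1/24) * hP (-1) + (7/24) * hP (2) + (-1/24) * hP (-2) + (-1/24) * hP (3)
  have hpc : p = c := by linear_combination (1/4) * e3 - p * A44
  have hr1 : r = 1 := by
    have : (c:ℂ) * (r - 1) = 0 := by rw [hpc] at e0; linear_combination e0
    exact sub_eq_zero.mp ((mul_eq_zero.mp this).resolve_left hcc)
  subst hr1
  have hp3 : p = 3 := by linear_combination A11
  have hq3 : q = 3 := by linear_combination (1/4) * e1 - e0 + hp3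
  have hL1 : L = 1 := by linear_combination A33 - hq3
  have hz : β' * β = 0 := by linear_combination hL1 - A44
  rw [hS, mul_eq_zero] at hz
  rcases hz with h | h
  · exact hβ (by simpa using h)
  · exact hβ h
end coefs

theorem stmt7 (n : ℕ) (hn : 0 < n) (a11 a21 a12 a22 a13 a23 : Fin n → ℂ)
    (c lam : ℝ) (hc : 0 < c) (hlam : 0 < lam)
    (ha13 : a13 = fun (j : Fin n) => if (j : ℕ) = 0 then ((lam : ℝ) : ℂ) else 0)
    (ha23 : a23 = 0)
    (hA : CondA 4 (fun z => z • a11 + z ^ 2 • a12 + z ^ 3 • a13)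
      (fun z => z • a21 + z ^ 2 • a22 + z ^ 3 • a23))
    (hB : CondB 4 c (fun z => z • a11 + z ^ 2 • a12 + z ^ 3 • a13)
      (fun z => z • a21 + z ^ 2 • a22 + z ^ 3 • a23)) :
    a21 ⟨0, hn⟩ = 0 := by
  subst ha23
  have hl : (lam : ℂ) ≠ 0 := by exact_mod_cast hlam.ne'
  have key : ∀ x : Fin n → ℂ, hinner x a13 = x ⟨0, hn⟩ * lam := by
    intro x
    unfold hinner
    rw [Finset.sum_eq_single (⟨0, hn⟩ : Fin n)]
    · simp [ha13]
    · intro j _ hj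
      have : (j : ℕ) ≠ 0 := fun h => hj (Fin.ext h)
      simp [ha13, this]
    · simp
  have h33 : hinner a13 a13 ≠ 0 := by
    rw [key]
    simp [ha13, hlam.ne']
  have h := final a11 a12 a13 a21 a22 c hc h33 hA hB
  rw [key] at h
  exact (mul_eq_zero.mp h).resolve_right hl
end
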